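/- arXiv:1006.3970 — 2 statements merged into one kernel-verified Lean document; each statement's English description precedes it below -/
import Mathlib

section
/- For every integer k > 1 there exists a constant C = C(k) > 0 such that for every symmetric Markov flow graph with layers L_0 = {s_0, s_1} and L_N = {t_0, t_1}, at most k nodes in each layer, and all node probabilities positive, every capacity-respecting flow from s_0 to t_1 has value at most C · p(s_0, t_1), where p(s_0, t_1) = Pr[X_0 = s_0 ∧ X_N = t_1]. -/
open Finset

/-- A (layered) Markov flow graph: layers `L 0, …, L N` of nodes (pairwise disjoint, nonempty),
an initial distribution `p0` on `L 0`, and transition probabilities `q` supported on pairs of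
consecutive layers, with rows summing to `1`. -/
structure MarkovFlow (V : Type) [Fintype V] [DecidableEq V] where
  N : ℕ
  one_le_N : 1 ≤ N
  L : ℕ → Finset V
  layer_nonempty : ∀ l, l ≤ N → (L l).Nonempty
  layer_disjoint : ∀ l m, l ≤ N → m ≤ N → l ≠ m → Disjoint (L l) (L m)
  p0 : V → ℝ
  p0_nonneg : ∀ u, 0 ≤ p0 u
  p0_supp : ∀ u, u ∉ L 0 → p0 u = 0
  p0_sum : ∑ u ∈ L 0, p0 u = 1
  q : V → V → ℝ
  q_nonneg : ∀ u v, 0 ≤ q u v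
  q_le_one : ∀ u v, q u v ≤ 1
  q_supp : ∀ u v, q u v ≠ 0 → ∃ l, l < N ∧ u ∈ L l ∧ v ∈ L (l + 1)
  q_row : ∀ l, l < N → ∀ u ∈ L l, ∑ v ∈ L (l + 1), q u v = 1

namespace MarkovFlow

variable {V : Type} [Fintype V] [DecidableEq V]

/-- The marginal probability `p(u) = Pr[X_l = u]`. -/
noncomputable def pm (M : MarkovFlow V) : ℕ → V → ℝ
  | 0 => M.p0
  | l + 1 => fun v => ∑ u, pm M l u * M.q u v

/-- The `d`-step transition probability from node `u`. -/
noncomputable def cond (M : MarkovFlow V) (u : V) : ℕ → V → ℝ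
  | 0 => fun v => if v = u then 1 else 0
  | d + 1 => fun v => ∑ w, cond M u d w * M.q w v

/-- The joint probability `p(u,v) = Pr[X_{l₁} = u ∧ X_{l₂} = v]` (for `l₁ ≤ l₂`). -/
noncomputable def pj (M : MarkovFlow V) (l₁ l₂ : ℕ) (u v : V) : ℝ :=
  pm M l₁ u * cond M u (l₂ - l₁) v

/-- `A(v) = Pr[X_0 = s₀ ∣ X_l = v] - 1/2 = p(s₀,v)/p(v) - 1/2`. -/
noncomputable def A (M : MarkovFlow V) (s₀ : V) (l : ℕ) (v : V) : ℝ :=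
  pj M 0 l s₀ v / pm M l v - 1 / 2

/-- The potential `φ(l) = Var[A(X_l)]`. -/
noncomputable def phi (M : MarkovFlow V) (s₀ : V) (l : ℕ) : ℝ :=
  (∑ v ∈ M.L l, pm M l v * (A M s₀ l v) ^ 2) - (∑ v ∈ M.L l, pm M l v * A M s₀ l v) ^ 2

end MarkovFlow

namespace MarkovFlow

variable {V : Type} [Fintype V] [DecidableEq V]

/-- Symmetry of a Markov flow graph: an involution of the nodes preserving each layer and the
transition probabilities, swapping `s₀` with `s₁` and `t₀` with `t₁`. -/
def Symm (M : MarkovFlow V) (s₀ s₁ t₀ t₁ : V) : Prop :=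
  ∃ σ : V → V, (∀ u, σ (σ u) = u) ∧
    (∀ l, l ≤ M.N → ∀ u ∈ M.L l, σ u ∈ M.L l) ∧
    σ s₀ = s₁ ∧ σ t₀ = t₁ ∧ ∀ u v, M.q (σ u) (σ v) = M.q u v

/-- The capacity of the edge `(u,v)`, namely `p(u,v) = p(u)·q(u,v)` when `u` lies in some layer
`l < N` (and `0` otherwise). -/
noncomputable def ecap (M : MarkovFlow V) (u v : V) : ℝ :=
  ∑ l ∈ Finset.range M.N, if u ∈ M.L l then pm M l u * M.q u v else 0

/-- `g` is a capacity-respecting flow from `s₀` to `t₁` of value `F`. -/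
def IsFlow (M : MarkovFlow V) (s₀ s₁ t₀ t₁ : V) (g : V → V → ℝ) (F : ℝ) : Prop :=
  (∀ l, l < M.N → ∀ u ∈ M.L l, ∀ v ∈ M.L (l + 1),
      0 ≤ g u v ∧ g u v ≤ pm M l u * M.q u v) ∧
  (∀ v, g s₁ v = 0) ∧ (∀ u, g u t₀ = 0) ∧
  (∀ l, 0 < l → l < M.N → ∀ w ∈ M.L l,
      ∑ u ∈ M.L (l - 1), g u w = ∑ v ∈ M.L (l + 1), g w v) ∧
  ∑ v ∈ M.L 1, g s₀ v = F

/-- A set `T` of edges separates `s₀` from `t₁`: every positive-capacity layered path from `s₀`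
to `t₁` uses an edge of `T`. -/
def Separates (M : MarkovFlow V) (s₀ t₁ : V) (T : Finset (V × V)) : Prop :=
  ∀ u : ℕ → V, u 0 = s₀ → u M.N = t₁ → (∀ l, l ≤ M.N → u l ∈ M.L l) →
    (∀ l, l < M.N → 0 < pm M l (u l) * M.q (u l) (u (l + 1))) →
    ∃ l, l < M.N ∧ (u l, u (l + 1)) ∈ T

end MarkovFlow

/-- A layered weighted graph with node masses `m` and edge weights `w` whose marginals are `m`,
together with node values `A` forming a backward martingale: the value of a node is the average of
the values of its predecessors. -/
structure BackwardMartingale (V : Type) where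
  N : ℕ
  L : ℕ → Finset V
  m : ℕ → V → ℝ
  w : ℕ → V → V → ℝ
  A : ℕ → V → ℝ
  m_nonneg : ∀ l u, 0 ≤ m l u
  w_nonneg : ∀ l u v, 0 ≤ w l u v
  sum_out : ∀ l, l < N → ∀ u ∈ L l, ∑ v ∈ L (l + 1), w l u v = m l u
  sum_in : ∀ l, l < N → ∀ v ∈ L (l + 1), ∑ u ∈ L l, w l u v = m (l + 1) v
  sum_val : ∀ l, l < N → ∀ v ∈ L (l + 1),
    ∑ u ∈ L l, w l u v * A l u = m (l + 1) v * A (l + 1) v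

/-- A `C^{1,1}` bump function supported on `[-1, 1]`. -/
noncomputable def bump (y : ℝ) : ℝ := max 0 (1 - y ^ 2) ^ 2

theorem bump_nonneg (y : ℝ) : 0 ≤ bump y := sq_nonneg _

theorem bump_le_one (y : ℝ) : bump y ≤ 1 := by
  unfold bump
  have h : max 0 (1 - y ^ 2) ≤ 1 := max_le zero_le_one (by nlinarith [sq_nonneg y])
  exact pow_le_one₀ (le_max_left _ _) h

theorem bump_eq_zero {y : ℝ} (h : 1 ≤ |y|) : bump y = 0 := by
  have : 1 - y ^ 2 ≤ 0 := by nlinarith [sq_abs y]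
  simp [bump, max_eq_left this]

theorem half_le_bump {y : ℝ} (h : |y| ≤ 1 / 2) : 1 / 2 ≤ bump y := by
  have h1 : y ^ 2 ≤ 1 / 4 := by nlinarith [sq_abs y, abs_nonneg y]
  unfold bump
  rw [max_eq_right (by linarith)]
  nlinarith

theorem bump_taylor (x y : ℝ) :
    |bump y - bump x + 4 * x * max 0 (1 - x ^ 2) * (y - x)| ≤ 12 * (y - x) ^ 2 := by
  unfold bump
  rcases le_total (1 - x ^ 2) 0 with hx | hx <;> rcases le_total (1 - y ^ 2) 0 with hy | hy
  · rw [max_eq_left hx, max_eq_left hy]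
    simp
    positivity
  · rw [max_eq_left hx, max_eq_right hy]
    have hd : (1 - y ^ 2) ≤ 2 * |y - x| := by
      have hx1 : 1 ≤ |x| := by
        by_contra! h
        nlinarith [sq_abs x, abs_nonneg x]
      have hy1 : |y| ≤ 1 := abs_le_one_iff_mul_self_le_one.2 (by nlinarith)
      have := abs_sub_abs_le_abs_sub x y
      rw [abs_sub_comm] at this
      nlinarith [sq_abs y, abs_nonneg y]
    have h2 : (1 - y ^ 2) ^ 2 ≤ 4 * (y - x) ^ 2 := by
      nlinarith [sq_abs (y - x), abs_nonneg (y - x)]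
    rw [abs_le]
    constructor <;> nlinarith [sq_nonneg (y - x), sq_nonneg (1 - y ^ 2)]
  · rw [max_eq_right hx, max_eq_left hy]
    have hy1 : 1 ≤ |y| := by
      by_contra! h
      nlinarith [sq_abs y, abs_nonneg y]
    have hx1 : |x| ≤ 1 := abs_le_one_iff_mul_self_le_one.2 (by nlinarith)
    have hd : (1 - x ^ 2) ≤ 2 * |y - x| := by
      have := abs_sub_abs_le_abs_sub y x
      nlinarith [sq_abs x, abs_nonneg x]
    have e : (0 : ℝ) ^ 2 - (1 - x ^ 2) ^ 2 + 4 * x * (1 - x ^ 2) * (y - x)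
        = (1 - x ^ 2) * (4 * x * (y - x) - (1 - x ^ 2)) := by ring
    rw [e, abs_mul, abs_of_nonneg hx]
    have h3 : |4 * x * (y - x) - (1 - x ^ 2)| ≤ 6 * |y - x| := by
      calc |4 * x * (y - x) - (1 - x ^ 2)| ≤ |4 * x * (y - x)| + |1 - x ^ 2| := abs_sub _ _
        _ = 4 * |x| * |y - x| + (1 - x ^ 2) := by
          rw [abs_mul, abs_mul, abs_of_nonneg hx]; norm_num
        _ ≤ 6 * |y - x| := by nlinarith [abs_nonneg (y - x)]
    calc (1 - x ^ 2) * |4 * x * (y - x) - (1 - x ^ 2)| ≤ (2 * |y - x|) * (6 * |y - x|) :=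
          mul_le_mul hd h3 (abs_nonneg _) (by positivity)
      _ = 12 * (y - x) ^ 2 := by rw [← sq_abs (y - x)]; ring
  · rw [max_eq_right hx, max_eq_right hy]
    have e : (1 - y ^ 2) ^ 2 - (1 - x ^ 2) ^ 2 + 4 * x * (1 - x ^ 2) * (y - x)
        = (3 * x ^ 2 + 2 * x * y + y ^ 2 - 2) * (y - x) ^ 2 := by ring
    rw [e, abs_mul, abs_of_nonneg (sq_nonneg (y - x))]
    refine mul_le_mul_of_nonneg_right (abs_le.2 ⟨?_, ?_⟩) (sq_nonneg _) <;>
      nlinarith [sq_nonneg (x - y), sq_nonneg (x + y), sq_nonneg x]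

/-- Finitely many points leave free one of sufficiently many disjoint balls. -/
theorem exists_empty_ball (r : ℕ) {ρ : ℝ} (hρ : 0 < ρ) (c : ℝ) (s : Finset ℝ) (hs : s.card ≤ r) :
    ∃ c' : ℝ, |c' - c| ≤ ρ / 4 ∧ ∀ x ∈ s, ρ / (4 * (r + 1)) ≤ |x - c'| := by
  by_contra! h
  set δ : ℝ := ρ / (4 * (r + 1)) with hδ
  have hδ0 : 0 < δ := by positivity
  have hδr : δ * (r + 1) = ρ / 4 := by rw [hδ]; field_simp
  have key : ∀ i : Fin (r + 1), ∃ x ∈ s, |x - (c - ρ / 4 + i * (2 * δ))| < δ := by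
    intro i
    apply h
    have hi : (i : ℝ) ≤ r := by exact_mod_cast Nat.lt_succ_iff.1 i.2
    have hi0 : (0 : ℝ) ≤ i := by positivity
    rw [abs_le]
    constructor <;> nlinarith
  choose f hf hfd using key
  have hinj : Function.Injective f := by
    intro i j hij
    have h1 := abs_lt.1 (hfd i)
    have h2 := abs_lt.1 (hfd j)
    rw [hij] at h1
    have h3 : (i : ℝ) < j + 1 := by nlinarith
    have h4 : (j : ℝ) < i + 1 := by nlinarith
    have h5 : (i : ℕ) < j + 1 := by exact_mod_cast h3
    have h6 : (j : ℕ) < i + 1 := by exact_mod_cast h4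
    exact Fin.ext (by omega)
  have := Finset.card_le_card_of_injOn (s := Finset.univ) f (fun i _ => hf i) hinj.injOn
  simp at this
  omega

namespace BackwardMartingale

variable {V : Type} (B : BackwardMartingale V)

/-- The expectation of `f (A (X_l))`. -/
noncomputable def expect (f : ℝ → ℝ) (l : ℕ) : ℝ := ∑ v ∈ B.L l, B.m l v * f (B.A l v)

/-- The energy dissipated between layers `l` and `l + 1`. -/
noncomputable def energy (l : ℕ) : ℝ :=
  ∑ u ∈ B.L l, ∑ v ∈ B.L (l + 1), B.w l u v * (B.A l u - B.A (l + 1) v) ^ 2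

/-- The capacity of the edges descending from above `θ` in layer `l` to at most `θ'` in
layer `l + 1`. -/
noncomputable def cut (l : ℕ) (θ θ' : ℝ) : ℝ :=
  ∑ u ∈ B.L l, ∑ v ∈ B.L (l + 1), if θ < B.A l u ∧ B.A (l + 1) v ≤ θ' then B.w l u v else 0

theorem energy_nonneg (l : ℕ) : 0 ≤ B.energy l :=
  Finset.sum_nonneg fun _ _ => Finset.sum_nonneg fun _ _ =>
    mul_nonneg (B.w_nonneg _ _ _) (sq_nonneg _)

theorem expect_eq_out (f : ℝ → ℝ) {l : ℕ} (hl : l < B.N) :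
    B.expect f l = ∑ u ∈ B.L l, ∑ v ∈ B.L (l + 1), B.w l u v * f (B.A l u) := by
  refine Finset.sum_congr rfl fun u hu => ?_
  rw [← Finset.sum_mul, B.sum_out l hl u hu]

theorem expect_eq_in (f : ℝ → ℝ) {l : ℕ} (hl : l < B.N) :
    B.expect f (l + 1) = ∑ u ∈ B.L l, ∑ v ∈ B.L (l + 1), B.w l u v * f (B.A (l + 1) v) := by
  rw [Finset.sum_comm]
  refine Finset.sum_congr rfl fun v hv => ?_
  rw [← Finset.sum_mul, B.sum_in l hl v hv]

theorem sum_mul_sub_eq_zero (g : ℝ → ℝ) {l : ℕ} (hl : l < B.N) :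
    ∑ u ∈ B.L l, ∑ v ∈ B.L (l + 1),
      B.w l u v * (g (B.A (l + 1) v) * (B.A l u - B.A (l + 1) v)) = 0 := by
  rw [Finset.sum_comm]
  refine Finset.sum_eq_zero fun v hv => ?_
  have h : ∀ u ∈ B.L l, B.w l u v * (g (B.A (l + 1) v) * (B.A l u - B.A (l + 1) v))
      = g (B.A (l + 1) v) * (B.w l u v * B.A l u)
        - g (B.A (l + 1) v) * B.A (l + 1) v * B.w l u v := fun u _ => by ring
  rw [Finset.sum_congr rfl h, Finset.sum_sub_distrib, ← Finset.mul_sum, ← Finset.mul_sum,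
    B.sum_in l hl v hv, B.sum_val l hl v hv]
  ring

/-- Expectations of functions with bounded second derivative change by at most the energy. -/
theorem abs_expect_succ_sub_le {f g : ℝ → ℝ} {K : ℝ}
    (hf : ∀ x y, |f y - f x - g x * (y - x)| ≤ K * (y - x) ^ 2) {l : ℕ} (hl : l < B.N) :
    |B.expect f (l + 1) - B.expect f l| ≤ K * B.energy l := by
  have e : B.expect f l - B.expect f (l + 1) = ∑ u ∈ B.L l, ∑ v ∈ B.L (l + 1),
      B.w l u v * (f (B.A l u) - f (B.A (l + 1) v)
        - g (B.A (l + 1) v) * (B.A l u - B.A (l + 1) v)) := by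
    rw [B.expect_eq_out f hl, B.expect_eq_in f hl]
    simp only [mul_sub (B.w l _ _) (f _ - f _), Finset.sum_sub_distrib,
      B.sum_mul_sub_eq_zero g hl, mul_sub (B.w l _ _) (f _), sub_zero]
  rw [abs_sub_comm, e, energy, Finset.mul_sum]
  refine (Finset.abs_sum_le_sum_abs _ _).trans (Finset.sum_le_sum fun u _ => ?_)
  rw [Finset.mul_sum]
  refine (Finset.abs_sum_le_sum_abs _ _).trans (Finset.sum_le_sum fun v _ => ?_)
  rw [abs_mul, abs_of_nonneg (B.w_nonneg _ _ _)]
  calc _ ≤ B.w l u v * (K * (B.A l u - B.A (l + 1) v) ^ 2) :=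
        mul_le_mul_of_nonneg_left (hf _ _) (B.w_nonneg _ _ _)
    _ = _ := by ring

/-- The second moment of the values drops exactly by the energy. -/
theorem energy_eq {l : ℕ} (hl : l < B.N) :
    B.energy l = B.expect (fun x => x ^ 2) l - B.expect (fun x => x ^ 2) (l + 1) := by
  have h0 := B.sum_mul_sub_eq_zero (fun x => 2 * x) hl
  rw [B.expect_eq_out _ hl, B.expect_eq_in _ hl, ← sub_zero (_ - _), ← h0]
  simp only [← Finset.sum_sub_distrib]
  refine Finset.sum_congr rfl fun u _ => Finset.sum_congr rfl fun v _ => by ring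

theorem sum_energy : ∀ n, n ≤ B.N → ∑ l ∈ Finset.range n, B.energy l
    = B.expect (fun x => x ^ 2) 0 - B.expect (fun x => x ^ 2) n
  | 0, _ => by simp
  | n + 1, hn => by
    rw [Finset.sum_range_succ, sum_energy n (by omega), B.energy_eq (by omega)]
    ring

/-- The smoothed mass of the nodes with value in the ball of center `c` and radius `ρ`. -/
noncomputable def ballMass (c ρ : ℝ) : ℕ → ℝ := B.expect fun x => bump ((x - c) / ρ)

theorem ballMass_nonneg (c ρ : ℝ) (l : ℕ) : 0 ≤ B.ballMass c ρ l :=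
  Finset.sum_nonneg fun _ _ => mul_nonneg (B.m_nonneg _ _) (bump_nonneg _)

theorem abs_ballMass_succ_sub_le (c : ℝ) {ρ : ℝ} (hρ : 0 < ρ) {l : ℕ} (hl : l < B.N) :
    |B.ballMass c ρ (l + 1) - B.ballMass c ρ l| ≤ 12 / ρ ^ 2 * B.energy l := by
  refine B.abs_expect_succ_sub_le
    (g := fun x => -(4 * ((x - c) / ρ) * max 0 (1 - ((x - c) / ρ) ^ 2)) / ρ) (fun x y => ?_) hl
  have h := bump_taylor ((x - c) / ρ) ((y - c) / ρ)
  have e : (y - c) / ρ - (x - c) / ρ = (y - x) / ρ := by ring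
  rw [e] at h
  convert h using 1
  · congr 1
    field_simp
    ring
  · field_simp

theorem abs_ballMass_sub_le (c : ℝ) {ρ : ℝ} (hρ : 0 < ρ) {a b : ℕ} (hab : a ≤ b) (hb : b ≤ B.N) :
    |B.ballMass c ρ b - B.ballMass c ρ a| ≤ 12 / ρ ^ 2 * ∑ l ∈ Finset.Ico a b, B.energy l := by
  induction b, hab using Nat.le_induction with
  | base => simp
  | succ b hab ih =>
    have h1 := ih (by omega)
    have h2 := B.abs_ballMass_succ_sub_le c hρ (l := b) (by omega)
    rw [Finset.sum_Ico_succ_top hab, mul_add]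
    have := abs_add_le (B.ballMass c ρ (b + 1) - B.ballMass c ρ b)
      (B.ballMass c ρ b - B.ballMass c ρ a)
    rw [sub_add_sub_cancel] at this
    linarith

theorem sum_energy_mono {a b a' b' : ℕ} (ha : a ≤ a') (hb : b' ≤ b) :
    ∑ l ∈ Finset.Ico a' b', B.energy l ≤ ∑ l ∈ Finset.Ico a b, B.energy l :=
  Finset.sum_le_sum_of_subset_of_nonneg (Finset.Ico_subset_Ico ha hb)
    fun _ _ _ => B.energy_nonneg _

theorem cut_le {l : ℕ} {θ θ' : ℝ} (h : V → V → ℝ)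
    (hh : ∀ u ∈ B.L l, ∀ v ∈ B.L (l + 1), 0 ≤ h u v)
    (hc : ∀ u ∈ B.L l, ∀ v ∈ B.L (l + 1), θ < B.A l u → B.A (l + 1) v ≤ θ' → B.w l u v ≤ h u v) :
    B.cut l θ θ' ≤ ∑ u ∈ B.L l, ∑ v ∈ B.L (l + 1), h u v := by
  refine Finset.sum_le_sum fun u hu => Finset.sum_le_sum fun v hv => ?_
  split_ifs with hif
  · exact hc u hu v hv hif.1 hif.2
  · exact hh u hu v hv

/-- Moving the threshold inside a ball costs at most the mass in the ball, up to energy. -/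
theorem cut_le_ballMass {c ρ : ℝ} (hρ : 0 < ρ) {l : ℕ} (hl : l < B.N) {θ θ' : ℝ}
    (hθ : |θ - c| ≤ ρ / 2) (hθ' : |θ' - c| ≤ ρ / 2) :
    B.cut l θ θ' ≤ 2 * B.ballMass c ρ l + 2 * B.ballMass c ρ (l + 1) + 1 / ρ ^ 2 * B.energy l := by
  have e : 2 * B.ballMass c ρ l + 2 * B.ballMass c ρ (l + 1) + 1 / ρ ^ 2 * B.energy l
      = ∑ u ∈ B.L l, ∑ v ∈ B.L (l + 1), (B.w l u v * (2 * bump ((B.A l u - c) / ρ)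
        + 2 * bump ((B.A (l + 1) v - c) / ρ) + ((B.A l u - B.A (l + 1) v) / ρ) ^ 2)) := by
    rw [ballMass, B.expect_eq_out _ hl, B.expect_eq_in _ hl, energy]
    simp only [Finset.mul_sum, ← Finset.sum_add_distrib]
    refine Finset.sum_congr rfl fun u _ => Finset.sum_congr rfl fun v _ => by
      field_simp
  rw [e]
  refine B.cut_le _ (fun u _ v _ => ?_) fun u _ v _ hu hv => ?_
  · have := bump_nonneg ((B.A l u - c) / ρ)
    have := bump_nonneg ((B.A (l + 1) v - c) / ρ)
    exact mul_nonneg (B.w_nonneg _ _ _) (by positivity)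
  · refine le_mul_of_one_le_right (B.w_nonneg _ _ _) ?_
    have h1 := bump_nonneg ((B.A l u - c) / ρ)
    have h2 := bump_nonneg ((B.A (l + 1) v - c) / ρ)
    have h3 := sq_nonneg ((B.A l u - B.A (l + 1) v) / ρ)
    rw [abs_le] at hθ hθ'
    have key : ∀ x : ℝ, c - ρ / 2 ≤ x → x ≤ c + ρ / 2 → 1 / 2 ≤ bump ((x - c) / ρ) := by
      intro x hx1 hx2
      refine half_le_bump ?_
      rw [abs_div, abs_of_pos hρ, div_le_iff₀ hρ, abs_le]
      constructor <;> linarith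
    by_cases hA : B.A l u ≤ c + ρ / 2
    · have := key _ (by linarith) hA
      linarith
    · by_cases hA' : c - ρ / 2 ≤ B.A (l + 1) v
      · have := key _ hA' (by linarith)
        linarith
      · push Not at hA hA'
        have : 1 ≤ (B.A l u - B.A (l + 1) v) / ρ := by
          rw [le_div_iff₀ hρ]
          linarith
        nlinarith

/-- A fixed threshold isolated from all values costs at most the energy. -/
theorem cut_le_energy {c ρ : ℝ} (hρ : 0 < ρ) {l : ℕ}
    (h : ∀ u ∈ B.L l, ρ ≤ |B.A l u - c|) : B.cut l c c ≤ 1 / ρ ^ 2 * B.energy l := by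
  rw [energy, Finset.mul_sum]
  simp only [Finset.mul_sum]
  refine B.cut_le _ (fun u _ v _ => ?_) fun u hu v _ huc hv => ?_
  · have := B.w_nonneg l u v
    positivity
  · have h1 := h u hu
    rw [abs_of_pos (by linarith)] at h1
    have h2 : 1 ≤ (B.A l u - B.A (l + 1) v) / ρ := by
      rw [le_div_iff₀ hρ]
      linarith
    have e : 1 / ρ ^ 2 * (B.w l u v * (B.A l u - B.A (l + 1) v) ^ 2)
        = B.w l u v * ((B.A l u - B.A (l + 1) v) / ρ) ^ 2 := by ring
    rw [e]
    exact le_mul_of_one_le_right (B.w_nonneg _ _ _) (by nlinarith)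

theorem cut_le_zero {l : ℕ} (h : B.energy l = 0) (c : ℝ) : B.cut l c c ≤ 0 := by
  have h1 := B.cut_le (l := l) (θ := c) (θ' := c) (fun _ _ => 0) (fun _ _ _ _ => le_rfl)
    (fun u hu v hv huc hvc => ?_)
  · simpa using h1
  · have h2 := (Finset.sum_eq_zero_iff_of_nonneg fun u _ => Finset.sum_nonneg fun v _ =>
      mul_nonneg (B.w_nonneg _ _ _) (sq_nonneg _)).1 h u hu
    have h3 := (Finset.sum_eq_zero_iff_of_nonneg fun v _ =>
      mul_nonneg (B.w_nonneg _ _ _) (sq_nonneg _)).1 h2 v hv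
    rcases mul_eq_zero.1 h3 with h4 | h4
    · exact h4.le
    · have := pow_eq_zero_iff (two_ne_zero) |>.1 h4
      linarith

/-- The nodes of layer `l` with value in the open ball of center `c` and radius `ρ`. -/
noncomputable def ballNodes (c ρ : ℝ) (l : ℕ) : Finset V :=
  {v ∈ B.L l | |B.A l v - c| < ρ}

theorem ballMass_le_two_mul {c ρ c' ρ' : ℝ} (hρ : 0 < ρ) (hρ' : 0 < ρ') {l : ℕ}
    (h : B.ballNodes c ρ l ⊆ B.ballNodes c' (ρ' / 2) l) :
    B.ballMass c ρ l ≤ 2 * B.ballMass c' ρ' l := by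
  rw [ballMass, ballMass, expect, expect, Finset.mul_sum]
  refine Finset.sum_le_sum fun v hv => ?_
  have hm := B.m_nonneg l v
  have hb := bump_nonneg ((B.A l v - c') / ρ')
  by_cases hc : |B.A l v - c| < ρ
  · have h1 := h (Finset.mem_filter.2 ⟨hv, hc⟩)
    have h2 : 1 / 2 ≤ bump ((B.A l v - c') / ρ') := by
      refine half_le_bump ?_
      rw [abs_div, abs_of_pos hρ', div_le_iff₀ hρ']
      linarith [(Finset.mem_filter.1 h1).2]
    nlinarith [bump_le_one ((B.A l v - c) / ρ)]
  · rw [bump_eq_zero]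
    · nlinarith
    · rw [abs_div, abs_of_pos hρ, le_div_iff₀ hρ]
      linarith

theorem ballMass_eq_zero {c ρ : ℝ} (hρ : 0 < ρ) {l : ℕ} (h : ∀ v ∈ B.L l, ρ ≤ |B.A l v - c|) :
    B.ballMass c ρ l = 0 := by
  refine Finset.sum_eq_zero fun v hv => ?_
  have h0 : bump ((B.A l v - c) / ρ) = 0 := bump_eq_zero <| by
    rw [abs_div, abs_of_pos hρ, le_div_iff₀ hρ]
    linarith [h v hv]
  simp [h0]

/-- Thresholds within `ρ / 2` of `c`, on the layers from `a` to `b`, whose total cut is at most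
`C` times the energy. -/
def HasCheapCut (c ρ C : ℝ) (a b : ℕ) : Prop :=
  ∃ θ : ℕ → ℝ, (∀ l, |θ l - c| ≤ ρ / 2) ∧
    ∑ l ∈ Finset.Ico a b, B.cut l (θ l) (θ (l + 1)) ≤ C * ∑ l ∈ Finset.Ico a b, B.energy l

/-- If the energy is small compared with the mass in a ball at the start, then some node of the
ball stays away from a smaller ball that was initially empty. -/
theorem exists_emptier_ball (r : ℕ) {c ρ : ℝ} (hρ : 0 < ρ) {a b : ℕ} (hb : b ≤ B.N)
    (hab : a ≤ b)
    (hr : ∀ l, a ≤ l → l ≤ b → (B.ballNodes c ρ l).card ≤ r + 1)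
    (hpos : 0 < B.ballMass c ρ a)
    (hE : ∑ l ∈ Finset.Ico a b, B.energy l
      ≤ (ρ / (4 * (r + 2))) ^ 2 / 72 * B.ballMass c ρ a) :
    ∃ c', |c' - c| ≤ ρ / 4 ∧
      ∀ l, a ≤ l → l ≤ b → (B.ballNodes c' (ρ / (4 * (r + 2)) / 2) l).card ≤ r := by
  have hρ₁ : 0 < ρ / (4 * ((r : ℝ) + 2)) := by positivity
  have hρ₁ρ : ρ / (4 * ((r : ℝ) + 2)) ≤ ρ / 4 := by
    refine div_le_div_of_nonneg_left hρ.le (by norm_num) ?_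
    have : (0 : ℝ) ≤ r := by positivity
    linarith
  classical
  obtain ⟨c', hc', hgap⟩ := exists_empty_ball (r + 1) hρ c ((B.ballNodes c ρ a).image (B.A a))
    (Finset.card_image_le.trans (hr a le_rfl hab))
  have er : ((r + 1 : ℕ) : ℝ) + 1 = (r : ℝ) + 2 := by push_cast; ring
  rw [er] at hgap
  set ρ₁ := ρ / (4 * ((r : ℝ) + 2))
  have hcabs := abs_le.1 hc'
  have hempty : ∀ v ∈ B.L a, ρ₁ ≤ |B.A a v - c'| := by
    intro v hv
    by_cases hvc : |B.A a v - c| < ρ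
    · exact hgap _ (Finset.mem_image_of_mem _ (Finset.mem_filter.2 ⟨hv, hvc⟩))
    · have := abs_sub_le (B.A a v) c' c
      linarith
  refine ⟨c', hc', fun l hal hlb => ?_⟩
  have hsub : B.ballNodes c' (ρ₁ / 2) l ⊆ B.ballNodes c ρ l := by
    intro v hv
    rw [ballNodes, Finset.mem_filter] at hv ⊢
    refine ⟨hv.1, ?_⟩
    have := abs_sub_le (B.A l v) c' c
    linarith [hv.2]
  have hssub : B.ballNodes c' (ρ₁ / 2) l ⊂ B.ballNodes c ρ l := by
    refine ⟨hsub, fun hcon => ?_⟩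
    have h1 := B.ballMass_le_two_mul hρ hρ₁ hcon
    have h2 := abs_le.1 (B.abs_ballMass_sub_le c hρ hal (hlb.trans hb))
    have h3 := abs_le.1 (B.abs_ballMass_sub_le c' hρ₁ hal (hlb.trans hb))
    rw [B.ballMass_eq_zero hρ₁ hempty] at h3
    set E := ∑ l ∈ Finset.Ico a b, B.energy l
    set E' := ∑ i ∈ Finset.Ico a l, B.energy i
    have hE' : E' ≤ ρ₁ ^ 2 / 72 * B.ballMass c ρ a :=
      (B.sum_energy_mono le_rfl hlb).trans hE
    have h4 : 12 / ρ₁ ^ 2 * E' ≤ B.ballMass c ρ a / 6 := by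
      calc 12 / ρ₁ ^ 2 * E' ≤ 12 / ρ₁ ^ 2 * (ρ₁ ^ 2 / 72 * B.ballMass c ρ a) := by gcongr
        _ = B.ballMass c ρ a / 6 := by field_simp; norm_num
    have hE0 : 0 ≤ E' := Finset.sum_nonneg fun _ _ => B.energy_nonneg _
    have h5 : 12 / ρ ^ 2 * E' ≤ 12 / ρ₁ ^ 2 * E' := by
      gcongr
      linarith
    linarith [h2.1, h3.2]
  have := Finset.card_lt_card hssub
  have := hr l hal hlb
  omega

/-- Main estimate: if a ball never contains more than `r` nodes, then thresholds inside the ball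
can be chosen whose total cut is bounded by the energy. -/
theorem exists_cheapCut (r : ℕ) : ∀ ρ : ℝ, 0 < ρ → ∃ C : ℝ, 0 < C ∧
    ∀ (V : Type) (B : BackwardMartingale V) (c : ℝ) (a b : ℕ), a ≤ b → b ≤ B.N →
      (∀ l, a ≤ l → l ≤ b → (B.ballNodes c ρ l).card ≤ r) → B.HasCheapCut c ρ C a b := by
  induction r with
  | zero =>
    intro ρ hρ
    refine ⟨1 / ρ ^ 2, by positivity, fun V B c a b _ _ h => ⟨fun _ => c, fun _ => ?_, ?_⟩⟩
    · rw [sub_self, abs_zero]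
      positivity
    · rw [Finset.mul_sum]
      refine Finset.sum_le_sum fun l hl => ?_
      rw [Finset.mem_Ico] at hl
      refine B.cut_le_energy hρ fun u hu => ?_
      by_contra! hlt
      have h0 := Finset.card_eq_zero.1 (Nat.le_zero.1 (h l hl.1 hl.2.le))
      exact Finset.notMem_empty u (h0 ▸ Finset.mem_filter.2 ⟨hu, hlt⟩)
  | succ r ih =>
    intro ρ hρ
    set ρ₁ := ρ / (4 * ((r : ℝ) + 2))
    have hρ₁ : 0 < ρ₁ := by positivity
    have hρ₁ρ : ρ₁ ≤ ρ / 4 := by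
      refine div_le_div_of_nonneg_left hρ.le (by norm_num) ?_
      have : (0 : ℝ) ≤ r := by positivity
      linarith
    obtain ⟨C, hC, hcut⟩ := ih (ρ₁ / 2) (by positivity)
    set κ := ρ₁ ^ 2 / 72
    have hκ : 0 < κ := by positivity
    refine ⟨C + 4 / κ + 49 / ρ ^ 2, by positivity, fun V B c a b hab hbN hr => ?_⟩
    have phase : ∀ a b : ℕ, a ≤ b → b ≤ B.N →
        (∀ l, a ≤ l → l ≤ b → (B.ballNodes c ρ l).card ≤ r + 1) →
        ∑ l ∈ Finset.Ico a b, B.energy l ≤ κ * B.ballMass c ρ a → B.HasCheapCut c ρ C a b := by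
      intro a b hab hbN hr hE
      rcases (B.ballMass_nonneg c ρ a).eq_or_lt with h0 | hpos
      · rw [← h0, mul_zero] at hE
        have hE0 := le_antisymm hE (Finset.sum_nonneg fun _ _ => B.energy_nonneg _)
        refine ⟨fun _ => c, fun _ => by rw [sub_self, abs_zero]; positivity, ?_⟩
        rw [hE0, mul_zero]
        refine Finset.sum_nonpos fun l hl => B.cut_le_zero ?_ c
        exact (Finset.sum_eq_zero_iff_of_nonneg fun _ _ => B.energy_nonneg _).1 hE0 l hl
      · obtain ⟨c', hc', hr'⟩ := B.exists_emptier_ball r hρ hbN hab hr hpos hE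
        obtain ⟨θ, hθ, hsum⟩ := hcut V B c' a b hab hbN hr'
        refine ⟨θ, fun l => ?_, hsum⟩
        have := abs_sub_le (θ l) c' c
        linarith [hθ l]
    obtain ⟨n, hn⟩ : ∃ n, n = b - a := ⟨_, rfl⟩
    induction n using Nat.strong_induction_on generalizing a with
    | _ n ihn =>
      by_cases hE : ∑ l ∈ Finset.Ico a b, B.energy l ≤ κ * B.ballMass c ρ a
      · obtain ⟨θ, hθ, hsum⟩ := phase a b hab hbN hr hE
        refine ⟨θ, hθ, hsum.trans (mul_le_mul_of_nonneg_right ?_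
          (Finset.sum_nonneg fun _ _ => B.energy_nonneg _))⟩
        have : 0 < 4 / κ + 49 / ρ ^ 2 := by positivity
        linarith
      · push Not at hE
        have hex : ∃ t, κ * B.ballMass c ρ a < ∑ l ∈ Finset.Ico a t, B.energy l := ⟨b, hE⟩
        classical
        obtain ⟨t, ht, hmin⟩ : ∃ t, κ * B.ballMass c ρ a < ∑ l ∈ Finset.Ico a t, B.energy l ∧
            ∀ s < t, ∑ l ∈ Finset.Ico a s, B.energy l ≤ κ * B.ballMass c ρ a :=
          ⟨Nat.find hex, Nat.find_spec hex, fun s hs => not_lt.1 (Nat.find_min hex hs)⟩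
        have hμ := B.ballMass_nonneg c ρ a
        have hat : a < t := by
          by_contra! h
          rw [Finset.Ico_eq_empty_of_le h, Finset.sum_empty] at ht
          exact absurd ht (not_lt.2 (by positivity))
        have htb : t ≤ b := by
          by_contra! h
          exact absurd hE (not_lt.2 (hmin b h))
        obtain ⟨s, rfl⟩ : ∃ s, t = s + 1 := ⟨t - 1, by omega⟩
        have has : a ≤ s := by omega
        obtain ⟨θ, hθ, hsum⟩ := phase a s has (by omega)
          (fun l h1 h2 => hr l h1 (by omega)) (hmin s (by omega))
        obtain ⟨θ', hθ', hsum'⟩ := ihn (b - (s + 1)) (by omega) (s + 1) htb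
          (fun l h1 h2 => hr l (by omega) h2) rfl
        refine ⟨fun l => if l ≤ s then θ l else θ' l, fun l => ?_, ?_⟩
        · dsimp only
          split_ifs
          exacts [hθ l, hθ' l]
        have hsplit := fun f : ℕ → ℝ => Finset.sum_Ico_consecutive f (hat.le) htb
        rw [← hsplit, ← hsplit, Finset.sum_Ico_succ_top has]
        have e1 : ∑ l ∈ Finset.Ico a s, B.cut l (if l ≤ s then θ l else θ' l)
            (if l + 1 ≤ s then θ (l + 1) else θ' (l + 1))
            = ∑ l ∈ Finset.Ico a s, B.cut l (θ l) (θ (l + 1)) := by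
          refine Finset.sum_congr rfl fun l hl => ?_
          rw [Finset.mem_Ico] at hl
          rw [if_pos (by omega), if_pos (by omega)]
        have e2 : ∑ l ∈ Finset.Ico (s + 1) b, B.cut l (if l ≤ s then θ l else θ' l)
            (if l + 1 ≤ s then θ (l + 1) else θ' (l + 1))
            = ∑ l ∈ Finset.Ico (s + 1) b, B.cut l (θ' l) (θ' (l + 1)) := by
          refine Finset.sum_congr rfl fun l hl => ?_
          rw [Finset.mem_Ico] at hl
          rw [if_neg (by omega), if_neg (by omega)]
        rw [e1, e2]
        simp only [le_refl, if_true, Nat.not_succ_le_self, if_false]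
        have hsw := B.cut_le_ballMass hρ (l := s) (by omega) (hθ s) (hθ' (s + 1))
        have hm1 := (abs_le.1 (B.abs_ballMass_sub_le c hρ has (by omega))).2
        have hm2 := (abs_le.1 (B.abs_ballMass_sub_le c hρ hat.le (by omega))).2
        set E := ∑ l ∈ Finset.Ico a (s + 1), B.energy l with hEdef
        have hE1 : ∑ l ∈ Finset.Ico a s, B.energy l ≤ E := B.sum_energy_mono le_rfl (by omega)
        have hE2 : B.energy s ≤ E := by
          rw [hEdef, Finset.sum_Ico_succ_top has]
          linarith [Finset.sum_nonneg fun l (_ : l ∈ Finset.Ico a s) => B.energy_nonneg l]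
        have hμE : B.ballMass c ρ a ≤ 1 / κ * E := by
          rw [one_div_mul_eq_div, le_div_iff₀ hκ]
          linarith
        have f1 : C * ∑ l ∈ Finset.Ico a s, B.energy l ≤ C * E := by gcongr
        have f2 : 12 / ρ ^ 2 * ∑ l ∈ Finset.Ico a s, B.energy l ≤ 12 / ρ ^ 2 * E := by gcongr
        have f3 : 1 / ρ ^ 2 * B.energy s ≤ 1 / ρ ^ 2 * E := by gcongr
        have e3 : (C + 4 / κ + 49 / ρ ^ 2) * E
            = C * E + 4 * (1 / κ * E) + 4 * (12 / ρ ^ 2 * E) + 1 / ρ ^ 2 * E := by ring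
        rw [mul_add, e3]
        linarith

end BackwardMartingale

namespace MarkovFlow

variable {V : Type} [Fintype V] [DecidableEq V] (M : MarkovFlow V)

theorem pm_nonneg : ∀ l v, 0 ≤ M.pm l v
  | 0, v => M.p0_nonneg v
  | l + 1, _ => Finset.sum_nonneg fun u _ => mul_nonneg (pm_nonneg l u) (M.q_nonneg _ _)

theorem q_eq_zero {l : ℕ} (hl : l < M.N) {u v : V} (hv : v ∈ M.L (l + 1)) (hu : u ∉ M.L l) :
    M.q u v = 0 := by
  by_contra h
  obtain ⟨l', hl', hu', hv'⟩ := M.q_supp u v h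
  by_cases e : l = l'
  · exact hu (e ▸ hu')
  · exact Finset.disjoint_left.1 (M.layer_disjoint (l + 1) (l' + 1) hl hl' (by omega)) hv hv'

theorem sum_mul_q {l : ℕ} (hl : l < M.N) {v : V} (hv : v ∈ M.L (l + 1)) (f : V → ℝ) :
    ∑ u, f u * M.q u v = ∑ u ∈ M.L l, f u * M.q u v :=
  (Finset.sum_subset (Finset.subset_univ _) fun u _ hu => by
    rw [M.q_eq_zero hl hv hu, mul_zero]).symm

/-- One step of the chain preserves total mass. -/
theorem sum_step {l : ℕ} (hl : l < M.N) (f : V → ℝ) :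
    ∑ v ∈ M.L (l + 1), ∑ u, f u * M.q u v = ∑ u ∈ M.L l, f u := by
  rw [Finset.sum_congr rfl fun v hv => M.sum_mul_q hl hv f, Finset.sum_comm]
  refine Finset.sum_congr rfl fun u hu => ?_
  rw [← Finset.mul_sum, M.q_row l hl u hu, mul_one]

theorem sum_pm : ∀ l, l ≤ M.N → ∑ v ∈ M.L l, M.pm l v = 1
  | 0, _ => M.p0_sum
  | l + 1, hl => (M.sum_step hl _).trans (sum_pm l (by omega))

theorem sum_cond {s : V} (hs : s ∈ M.L 0) : ∀ l, l ≤ M.N → ∑ v ∈ M.L l, M.cond s l v = 1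
  | 0, _ => by simp [cond, hs]
  | l + 1, hl => (M.sum_step hl _).trans (sum_cond hs l (by omega))

theorem cond_nonneg (s : V) : ∀ l v, 0 ≤ M.cond s l v
  | 0, v => by
    change 0 ≤ if v = s then (1 : ℝ) else 0
    split_ifs <;> norm_num
  | l + 1, _ => Finset.sum_nonneg fun u _ => mul_nonneg (cond_nonneg s l u) (M.q_nonneg _ _)

theorem pm_mul_A {s : V} {l : ℕ} {v : V} (h : 0 < M.pm l v) :
    M.pm l v * M.A s l v = M.p0 s * M.cond s l v - M.pm l v / 2 := by
  rw [A, pj, pm, Nat.sub_zero]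
  field_simp

/-- The posterior of the source is a backward martingale along the chain. -/
noncomputable def posterior (s : V) (hpos : ∀ l, l ≤ M.N → ∀ u ∈ M.L l, 0 < M.pm l u) :
    BackwardMartingale V where
  N := M.N
  L := M.L
  m := M.pm
  w l u v := M.pm l u * M.q u v
  A := M.A s
  m_nonneg := M.pm_nonneg
  w_nonneg l u v := mul_nonneg (M.pm_nonneg l u) (M.q_nonneg u v)
  sum_out l hl u hu := by rw [← Finset.mul_sum, M.q_row l hl u hu, mul_one]
  sum_in l hl v hv := (M.sum_mul_q hl hv _).symm
  sum_val l hl v hv := by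
    rw [M.pm_mul_A (hpos (l + 1) hl v hv)]
    have h : ∀ u ∈ M.L l, M.pm l u * M.q u v * M.A s l u
        = M.p0 s * (M.cond s l u * M.q u v) - 1 / 2 * (M.pm l u * M.q u v) := fun u hu => by
      rw [mul_right_comm, M.pm_mul_A (hpos l hl.le u hu)]
      ring
    rw [Finset.sum_congr rfl h, Finset.sum_sub_distrib, ← Finset.mul_sum, ← Finset.mul_sum,
      ← M.sum_mul_q hl hv, ← M.sum_mul_q hl hv]
    change _ = M.p0 s * ∑ u, M.cond s l u * M.q u v - (∑ u, M.pm l u * M.q u v) / 2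
    ring

theorem pm_involution {σ : V → V} (hσ : Function.Involutive σ)
    (h0 : ∀ u, M.p0 (σ u) = M.p0 u) (hq : ∀ u v, M.q (σ u) (σ v) = M.q u v) :
    ∀ l v, M.pm l (σ v) = M.pm l v
  | 0, v => h0 v
  | l + 1, v => by
    change ∑ u, M.pm l u * M.q u (σ v) = ∑ u, M.pm l u * M.q u v
    rw [← Equiv.sum_comp hσ.toPerm]
    refine Finset.sum_congr rfl fun u _ => ?_
    rw [Function.Involutive.coe_toPerm, pm_involution hσ h0 hq l, hq]

/-- By symmetry, both sinks have probability `1 / 2`. -/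
theorem pm_sink {s₀ s₁ t₀ t₁ : V} (hL0 : M.L 0 = {s₀, s₁}) (h0 : M.p0 s₀ = 1 / 2)
    (h1 : M.p0 s₁ = 1 / 2) (hLN : M.L M.N = {t₀, t₁}) (ht : t₀ ≠ t₁)
    (hsymm : M.Symm s₀ s₁ t₀ t₁) : M.pm M.N t₀ = 1 / 2 ∧ M.pm M.N t₁ = 1 / 2 := by
  obtain ⟨σ, hσ, hσL, hs, hts, hq⟩ := hsymm
  have hp : ∀ u, M.p0 (σ u) = M.p0 u := by
    have hhalf : ∀ u ∈ M.L 0, M.p0 u = 1 / 2 := by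
      intro u hu
      rw [hL0, Finset.mem_insert, Finset.mem_singleton] at hu
      rcases hu with rfl | rfl <;> assumption
    intro u
    by_cases hu : u ∈ M.L 0
    · rw [hhalf u hu, hhalf _ (hσL 0 (Nat.zero_le _) u hu)]
    · have hu' : σ u ∉ M.L 0 := fun h => hu (hσ u ▸ hσL 0 (Nat.zero_le _) _ h)
      rw [M.p0_supp u hu, M.p0_supp _ hu']
  have heq := M.pm_involution hσ hp hq M.N t₀
  have hsum := M.sum_pm M.N le_rfl
  rw [hLN, Finset.sum_pair ht] at hsum
  rw [hts] at heq
  constructor <;> linarith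

/-- A flow is bounded by the capacity of any cut given by thresholds on the posterior. -/
theorem flow_le_sum_cut {s₀ s₁ t₀ t₁ : V}
    (hpos : ∀ l, l ≤ M.N → ∀ u ∈ M.L l, 0 < M.pm l u)
    (hL0 : M.L 0 = {s₀, s₁}) (hLN : M.L M.N = {t₀, t₁}) {g : V → V → ℝ} {F : ℝ}
    (hg : M.IsFlow s₀ s₁ t₀ t₁ g F) (θ : ℕ → ℝ) (hs : θ 0 < M.A s₀ 0 s₀)
    (ht : M.A s₀ M.N t₁ ≤ θ M.N) :
    F ≤ ∑ l ∈ Finset.range M.N, (M.posterior s₀ hpos).cut l (θ l) (θ (l + 1)) := by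
  obtain ⟨hcap, hg1, hg0, hcons, hF⟩ := hg
  set inflow : ℕ → V → ℝ := fun l v =>
    if l = 0 then ∑ w ∈ M.L 1, g v w else ∑ u ∈ M.L (l - 1), g u v with hin
  set G : ℕ → ℝ := fun l => ∑ v ∈ M.L l with θ l < M.A s₀ l v, inflow l v with hG
  have hout : ∀ l, l < M.N → ∀ u ∈ M.L l, inflow l u = ∑ v ∈ M.L (l + 1), g u v := by
    intro l hl u hu
    rcases Nat.eq_zero_or_pos l with rfl | hl0
    · simp [hin]
    · simp only [hin, if_neg hl0.ne']
      exact hcons l hl0 hl u hu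
  have hG0 : F = G 0 := by
    have h : G 0 = inflow 0 s₀ := Finset.sum_eq_single s₀ (fun u hu hne => ?_) fun h => ?_
    · rw [h, ← hF]
      simp [hin]
    · rw [Finset.mem_filter, hL0, Finset.mem_insert, Finset.mem_singleton] at hu
      simp [hin, hu.1.resolve_left hne, hg1]
    · exact (h (by simp [hL0, hs])).elim
  have hGN : G M.N = 0 := by
    refine Finset.sum_eq_zero fun v hv => ?_
    rw [Finset.mem_filter, hLN, Finset.mem_insert, Finset.mem_singleton] at hv
    rcases hv with ⟨rfl | rfl, hv⟩
    · have := M.one_le_N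
      simp [hin, hg0, show M.N ≠ 0 by omega]
    · exact absurd hv (not_lt.2 ht)
  have hstep : ∀ l, l < M.N → G l - G (l + 1)
      ≤ (M.posterior s₀ hpos).cut l (θ l) (θ (l + 1)) := by
    intro l hl
    have e1 : G l = ∑ u ∈ M.L l, ∑ v ∈ M.L (l + 1), if θ l < M.A s₀ l u then g u v else 0 := by
      rw [hG]
      dsimp only
      rw [Finset.sum_filter]
      refine Finset.sum_congr rfl fun u hu => ?_
      split_ifs
      · exact hout l hl u hu
      · simp
    have e2 : G (l + 1)
        = ∑ u ∈ M.L l, ∑ v ∈ M.L (l + 1), if θ (l + 1) < M.A s₀ (l + 1) v then g u v else 0 := by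
      rw [hG, Finset.sum_comm]
      dsimp only
      rw [Finset.sum_filter]
      refine Finset.sum_congr rfl fun v hv => ?_
      split_ifs <;> simp [hin]
    rw [e1, e2, ← Finset.sum_sub_distrib]
    refine Finset.sum_le_sum fun u hu => ?_
    rw [← Finset.sum_sub_distrib]
    refine Finset.sum_le_sum fun v hv => ?_
    obtain ⟨h0, h1⟩ := hcap l hl u hu v hv
    change _ ≤ if θ l < M.A s₀ l u ∧ M.A s₀ (l + 1) v ≤ θ (l + 1) then M.pm l u * M.q u v else 0
    by_cases ha : θ l < M.A s₀ l u <;> by_cases hb : θ (l + 1) < M.A s₀ (l + 1) v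
    · simp [ha, hb, not_le.2 hb]
    · simpa [ha, hb, not_lt.1 hb] using h1
    · simpa [ha, hb] using h0
    · simp [ha, hb]
  calc F = G 0 - G M.N := by rw [hGN, sub_zero, hG0]
    _ = ∑ l ∈ Finset.range M.N, (G l - G (l + 1)) := (Finset.sum_range_sub' _ _).symm
    _ ≤ _ := Finset.sum_le_sum fun l hl => hstep l (Finset.mem_range.1 hl)

end MarkovFlow

/-- Theorem 2 of the paper: for every `k > 1` there is a constant `C(k) > 0`
such that in every symmetric Markov flow graph with sources `{s₀,s₁}`, sinks `{t₀,t₁}`, at most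
`k` nodes per layer and all node probabilities positive, every capacity-respecting flow from
`s₀` to `t₁` has value at most `C · Pr[X_0 = s₀ ∧ X_N = t₁]`. -/
theorem stmt6 (k : ℕ) (hk : 1 < k) :
    ∃ C : ℝ, 0 < C ∧
      ∀ (V : Type) [Fintype V] [DecidableEq V],
      ∀ (M : MarkovFlow V) (s₀ s₁ t₀ t₁ : V),
        M.L 0 = {s₀, s₁} → s₀ ≠ s₁ → M.p0 s₀ = 1 / 2 → M.p0 s₁ = 1 / 2 →
        M.L M.N = {t₀, t₁} → t₀ ≠ t₁ →
        (∀ l, l ≤ M.N → ∀ u ∈ M.L l, 0 < MarkovFlow.pm M l u) →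
        (∀ l, l ≤ M.N → (M.L l).card ≤ k) →
        M.Symm s₀ s₁ t₀ t₁ →
        ∀ (g : V → V → ℝ) (F : ℝ), M.IsFlow s₀ s₁ t₀ t₁ g F →
          F ≤ C * MarkovFlow.pj M 0 M.N s₀ t₁ := by
  obtain ⟨C, hC, hcut⟩ := BackwardMartingale.exists_cheapCut k (1 / 2) (by norm_num)
  refine ⟨2 * C + 4, by positivity, ?_⟩
  intro V _ _ M s₀ s₁ t₀ t₁ hL0 hs hp0 hp1 hLN ht hpos hcard hsymm g F hg
  have hs0 : s₀ ∈ M.L 0 := by simp [hL0]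
  have ht0 : t₀ ∈ M.L M.N := by simp [hLN]
  have ht1 : t₁ ∈ M.L M.N := by simp [hLN]
  obtain ⟨hpt0, hpt1⟩ := M.pm_sink hL0 hp0 hp1 hLN ht hsymm
  set P := MarkovFlow.pj M 0 M.N s₀ t₁ with hP
  have hPc : P = 1 / 2 * M.cond s₀ M.N t₁ := by
    rw [hP, MarkovFlow.pj, MarkovFlow.pm, hp0, Nat.sub_zero]
  have hP0 : 0 ≤ P := by
    rw [hPc]
    exact mul_nonneg (by norm_num) (M.cond_nonneg _ _ _)
  have hsum := M.sum_cond hs0 M.N le_rfl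
  rw [hLN, Finset.sum_pair ht] at hsum
  have hA : M.A s₀ M.N t₁ = 2 * P - 1 / 2 := by
    have := M.pm_mul_A (s := s₀) (hpos M.N le_rfl t₁ ht1)
    rw [hpt1, hp0] at this
    linarith
  have hA' : M.A s₀ M.N t₀ = 1 / 2 - 2 * P := by
    have := M.pm_mul_A (s := s₀) (hpos M.N le_rfl t₀ ht0)
    rw [hpt0, hp0] at this
    linarith
  have hAs0 : M.A s₀ 0 s₀ = 1 / 2 := by
    simp [MarkovFlow.A, MarkovFlow.pj, MarkovFlow.pm, MarkovFlow.cond, hp0]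
    norm_num
  have hAs1 : M.A s₀ 0 s₁ = -(1 / 2) := by
    simp [MarkovFlow.A, MarkovFlow.pj, MarkovFlow.pm, MarkovFlow.cond, hs.symm]
  rcases le_or_gt (1 / 8) P with hP8 | hP8
  · have hF : F ≤ 1 / 2 := by
      rw [← hg.2.2.2.2]
      calc ∑ v ∈ M.L 1, g s₀ v ≤ ∑ v ∈ M.L (0 + 1), M.pm 0 s₀ * M.q s₀ v :=
            Finset.sum_le_sum fun v hv => (hg.1 0 M.one_le_N s₀ hs0 v hv).2
        _ = 1 / 2 := by
          rw [← Finset.mul_sum, M.q_row 0 M.one_le_N s₀ hs0, mul_one, MarkovFlow.pm, hp0]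
    nlinarith
  · obtain ⟨θ, hθ, hθcut⟩ := hcut V (M.posterior s₀ hpos) 0 0 M.N (Nat.zero_le _) le_rfl
      fun l _ hl => (Finset.card_filter_le _ _).trans (hcard l hl)
    have h0 := abs_le.1 (hθ 0)
    have hN := abs_le.1 (hθ M.N)
    have hflow := M.flow_le_sum_cut hpos hL0 hLN hg θ (by linarith [h0.2]) (by linarith [hN.1])
    have hE : ∑ l ∈ Finset.range M.N, (M.posterior s₀ hpos).energy l ≤ 2 * P := by
      rw [(M.posterior s₀ hpos).sum_energy M.N le_rfl]
      have e0 : (M.posterior s₀ hpos).expect (fun x => x ^ 2) 0 = 1 / 4 := by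
        change ∑ v ∈ M.L 0, M.p0 v * M.A s₀ 0 v ^ 2 = _
        rw [hL0, Finset.sum_pair hs, hp0, hp1, hAs0, hAs1]
        norm_num
      have eN : (M.posterior s₀ hpos).expect (fun x => x ^ 2) M.N = (1 / 2 - 2 * P) ^ 2 := by
        change ∑ v ∈ M.L M.N, M.pm M.N v * M.A s₀ M.N v ^ 2 = _
        rw [hLN, Finset.sum_pair ht, hpt0, hpt1, hA, hA']
        ring
      rw [e0, eN]
      nlinarith
    rw [← Finset.range_eq_Ico] at hθcut
    nlinarith [mul_le_mul_of_nonneg_left hE hC.le]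
end

section
/- For every integer k > 0 there exists a constant C = C(k) > 0 such that for every symmetric Markov flow graph with at most k nodes per layer, all node probabilities positive, and A(t_1) < 0, there exists a set T of edges separating s_0 from t_1 whose capacity is at most C·(φ(0) − φ(N)). -/
open Finset

namespace MarkovFlow

variable {V : Type} [Fintype V] [DecidableEq V] (M : MarkovFlow V) (s₀ : V)

/-- The expected squared increment of `A` between the layers `l` and `l + 1`. -/
noncomputable def stepEnergy (l : ℕ) : ℝ :=
  ∑ u ∈ M.L l, ∑ v ∈ M.L (l + 1), pm M l u * M.q u v * (A M s₀ l u - A M s₀ (l + 1) v) ^ 2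

/-- The expected quadratic variation of `A` between the layers `a` and `b`. -/
noncomputable def energy (a b : ℕ) : ℝ :=
  ∑ l ∈ Ico a b, stepEnergy M s₀ l

/-- The capacity of the edges leaving `P` in layer `l` and avoiding `Q` in layer `l + 1`. -/
noncomputable def crossCap (l : ℕ) (P Q : Finset V) : ℝ :=
  ∑ u ∈ P, ∑ v ∈ M.L (l + 1) \ Q, pm M l u * M.q u v

/-- The set `P` of nodes of layer `l` contains all nodes with `hi ≤ A` and none with `A ≤ lo`. -/
def IsLevelSet (lo hi : ℝ) (l : ℕ) (P : Finset V) : Prop :=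
  P ⊆ M.L l ∧ ∀ v ∈ M.L l, (hi ≤ A M s₀ l v → v ∈ P) ∧ (v ∈ P → lo < A M s₀ l v)

/-- The nodes of layer `l` with `A` strictly between `lo` and `hi`. -/
noncomputable def band (lo hi : ℝ) (l : ℕ) : Finset V :=
  (M.L l).filter fun v => lo < A M s₀ l v ∧ A M s₀ l v < hi

variable {M s₀}

lemma IsLevelSet.mono {lo hi lo' hi' : ℝ} {l : ℕ} {P : Finset V}
    (h : IsLevelSet M s₀ lo hi l P) (hlo : lo' ≤ lo) (hhi : hi ≤ hi') :
    IsLevelSet M s₀ lo' hi' l P :=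
  ⟨h.1, fun v hv => ⟨fun hA => (h.2 v hv).1 (hhi.trans hA),
    fun hP => hlo.trans_lt ((h.2 v hv).2 hP)⟩⟩

lemma isLevelSet_superlevel {lo c hi : ℝ} (hlo : lo < c) (hhi : c ≤ hi) (l : ℕ) :
    IsLevelSet M s₀ lo hi l ((M.L l).filter fun v => c ≤ A M s₀ l v) :=
  ⟨filter_subset _ _, fun _ hv => ⟨fun h => mem_filter.2 ⟨hv, hhi.trans h⟩,
    fun h => hlo.trans_le (mem_filter.1 h).2⟩⟩

lemma layer_eq {l m : ℕ} (hl : l ≤ M.N) (hm : m ≤ M.N) {u : V} (hu : u ∈ M.L l)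
    (hu' : u ∈ M.L m) : l = m := by
  by_contra h
  exact disjoint_left.1 (M.layer_disjoint l m hl hm h) hu hu'

lemma mem_succ_of_q_ne_zero {l : ℕ} (hl : l ≤ M.N) {u v : V} (hu : u ∈ M.L l)
    (hq : M.q u v ≠ 0) : v ∈ M.L (l + 1) := by
  obtain ⟨m, hm, hum, hvm⟩ := M.q_supp u v hq
  rwa [layer_eq hl hm.le hu hum]

lemma pm_eq_zero {l : ℕ} (hl : l ≤ M.N) {u : V} (hu : u ∉ M.L l) : pm M l u = 0 := by
  induction l generalizing u with
  | zero => exact M.p0_supp u hu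
  | succ l ih =>
    refine sum_eq_zero fun w _ => ?_
    by_cases hw : w ∈ M.L l
    · rw [mul_eq_zero]
      right
      by_contra h
      exact hu (mem_succ_of_q_ne_zero (by omega) hw h)
    · rw [ih (by omega) hw, zero_mul]

lemma cond_eq_zero (hs : s₀ ∈ M.L 0) {l : ℕ} (hl : l ≤ M.N) {u : V} (hu : u ∉ M.L l) :
    cond M s₀ l u = 0 := by
  induction l generalizing u with
  | zero =>
    refine if_neg fun h => hu ?_
    rwa [h]
  | succ l ih =>
    refine sum_eq_zero fun w _ => ?_
    by_cases hw : w ∈ M.L l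
    · rw [mul_eq_zero]
      right
      by_contra h
      exact hu (mem_succ_of_q_ne_zero (by omega) hw h)
    · rw [ih (by omega) hw, zero_mul]

lemma sum_pm_mul_q {l : ℕ} (hl : l < M.N) (v : V) :
    ∑ u ∈ M.L l, pm M l u * M.q u v = pm M (l + 1) v :=
  sum_subset (subset_univ _) fun u _ hu => by rw [pm_eq_zero hl.le hu, zero_mul]

lemma sum_cond_mul_q (hs : s₀ ∈ M.L 0) {l : ℕ} (hl : l < M.N) (v : V) :
    ∑ u ∈ M.L l, cond M s₀ l u * M.q u v = cond M s₀ (l + 1) v :=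
  sum_subset (subset_univ _) fun u _ hu => by rw [cond_eq_zero hs hl.le hu, zero_mul]

lemma pm_mul_A_s11 {l : ℕ} {u : V} (hu : 0 < pm M l u) :
    pm M l u * A M s₀ l u = M.p0 s₀ * cond M s₀ l u - pm M l u / 2 := by
  simp only [A, pj, pm, Nat.sub_zero]
  field_simp

/-- In reverse time, `A` is a martingale. -/
lemma sum_pm_mul_q_mul_A (hs : s₀ ∈ M.L 0) (hpos : ∀ l, l ≤ M.N → ∀ u ∈ M.L l, 0 < pm M l u)
    {l : ℕ} (hl : l < M.N) {v : V} (hv : v ∈ M.L (l + 1)) :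
    ∑ u ∈ M.L l, pm M l u * M.q u v * A M s₀ l u = pm M (l + 1) v * A M s₀ (l + 1) v := by
  rw [pm_mul_A_s11 (hpos _ hl _ hv), ← sum_cond_mul_q hs hl, ← sum_pm_mul_q hl, mul_sum, sum_div,
    ← sum_sub_distrib]
  refine sum_congr rfl fun u hu => ?_
  rw [mul_right_comm, pm_mul_A_s11 (hpos _ hl.le _ hu)]
  ring

lemma sum_sq_sub (hs : s₀ ∈ M.L 0) (hpos : ∀ l, l ≤ M.N → ∀ u ∈ M.L l, 0 < pm M l u)
    {l : ℕ} (hl : l < M.N) {v : V} (hv : v ∈ M.L (l + 1)) (z : ℝ) :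
    ∑ u ∈ M.L l, pm M l u * M.q u v * (A M s₀ l u - z) ^ 2 =
      ∑ u ∈ M.L l, pm M l u * M.q u v * (A M s₀ l u - A M s₀ (l + 1) v) ^ 2 +
        pm M (l + 1) v * (A M s₀ (l + 1) v - z) ^ 2 := by
  set y := A M s₀ (l + 1) v with hy
  have h1 : ∀ u, pm M l u * M.q u v * (A M s₀ l u - z) ^ 2 =
      pm M l u * M.q u v * (A M s₀ l u - y) ^ 2 +
        (2 * (y - z) * (pm M l u * M.q u v * A M s₀ l u) +
          ((y - z) ^ 2 - 2 * (y - z) * y) * (pm M l u * M.q u v)) := fun u => by ring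
  rw [sum_congr rfl fun u _ => h1 u, sum_add_distrib, sum_add_distrib, ← mul_sum, ← mul_sum,
    sum_pm_mul_q_mul_A hs hpos hl hv, sum_pm_mul_q hl, ← hy]
  ring

lemma pm_nonneg_s11 (l : ℕ) (u : V) : 0 ≤ pm M l u := by
  induction l generalizing u with
  | zero => exact M.p0_nonneg u
  | succ l ih => exact sum_nonneg fun w _ => mul_nonneg (ih w) (M.q_nonneg w u)

lemma flow_nonneg (l : ℕ) (u v : V) : 0 ≤ pm M l u * M.q u v :=
  mul_nonneg (pm_nonneg_s11 l u) (M.q_nonneg u v)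

lemma stepEnergy_nonneg (l : ℕ) : 0 ≤ stepEnergy M s₀ l :=
  sum_nonneg fun u _ => sum_nonneg fun v _ => mul_nonneg (flow_nonneg l u v) (sq_nonneg _)

lemma energy_nonneg (a b : ℕ) : 0 ≤ energy M s₀ a b :=
  sum_nonneg fun l _ => stepEnergy_nonneg l

lemma energy_add {a b c : ℕ} (hab : a ≤ b) (hbc : b ≤ c) :
    energy M s₀ a b + energy M s₀ b c = energy M s₀ a c :=
  sum_Ico_consecutive _ hab hbc

lemma sum_layer_q_mul {l : ℕ} (hl : l < M.N) (f : V → ℝ) :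
    ∑ u ∈ M.L l, ∑ v ∈ M.L (l + 1), pm M l u * M.q u v * f u = ∑ u ∈ M.L l, pm M l u * f u := by
  refine sum_congr rfl fun u hu => ?_
  rw [← sum_mul, ← mul_sum, M.q_row l hl u hu, mul_one]

lemma phi_sub_phi_succ (hs : s₀ ∈ M.L 0)
    (hpos : ∀ l, l ≤ M.N → ∀ u ∈ M.L l, 0 < pm M l u) {l : ℕ} (hl : l < M.N) :
    phi M s₀ l - phi M s₀ (l + 1) = stepEnergy M s₀ l := by
  have h1 : ∑ u ∈ M.L l, pm M l u * A M s₀ l u =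
      ∑ v ∈ M.L (l + 1), pm M (l + 1) v * A M s₀ (l + 1) v := by
    rw [← sum_layer_q_mul hl, sum_comm]
    exact sum_congr rfl fun v hv => sum_pm_mul_q_mul_A hs hpos hl hv
  have h2 : ∑ u ∈ M.L l, pm M l u * A M s₀ l u ^ 2 =
      stepEnergy M s₀ l + ∑ v ∈ M.L (l + 1), pm M (l + 1) v * A M s₀ (l + 1) v ^ 2 := by
    rw [← sum_layer_q_mul hl, stepEnergy, sum_comm, sum_comm (s := M.L l), ← sum_add_distrib]
    exact sum_congr rfl fun v hv => by simpa using sum_sq_sub hs hpos hl hv 0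
  rw [phi, phi, h1, h2]
  ring

lemma phi_sub_phi (hs : s₀ ∈ M.L 0) (hpos : ∀ l, l ≤ M.N → ∀ u ∈ M.L l, 0 < pm M l u) :
    phi M s₀ 0 - phi M s₀ M.N = energy M s₀ 0 M.N := by
  rw [energy, ← Finset.range_eq_Ico, ← sum_range_sub']
  exact sum_congr rfl fun l hl => phi_sub_phi_succ hs hpos (mem_range.1 hl)

/-- Mass leaving a layer `t` backwards in time spreads around `z` by at most the energy spent. -/
lemma exists_backward_weight (hs : s₀ ∈ M.L 0)
    (hpos : ∀ l, l ≤ M.N → ∀ u ∈ M.L l, 0 < pm M l u) (z : ℝ) {s t : ℕ} (hst : s ≤ t)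
    (ht : t ≤ M.N) (c : V → ℝ) (hc0 : ∀ u, 0 ≤ c u) (hc1 : ∀ u ∈ M.L t, c u ≤ 1) :
    ∃ c' : V → ℝ, (∀ u, 0 ≤ c' u) ∧ (∀ u ∈ M.L s, c' u ≤ 1) ∧
      ∑ u ∈ M.L s, pm M s u * c' u = ∑ v ∈ M.L t, pm M t v * c v ∧
      ∑ u ∈ M.L s, pm M s u * c' u * (A M s₀ s u - z) ^ 2 ≤
        ∑ v ∈ M.L t, pm M t v * c v * (A M s₀ t v - z) ^ 2 + energy M s₀ s t := by
  induction t, hst using Nat.le_induction generalizing c with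
  | base => exact ⟨c, hc0, hc1, rfl, by simp [energy]⟩
  | succ t hst ih =>
    have hl : t < M.N := ht
    obtain ⟨c', h0, h1, hmass, hvar⟩ := ih hl.le (fun u => ∑ v ∈ M.L (t + 1), M.q u v * c v)
      (fun u => sum_nonneg fun v _ => mul_nonneg (M.q_nonneg u v) (hc0 v))
      (fun u hu => by
        rw [← M.q_row t hl u hu]
        exact sum_le_sum fun v hv => mul_le_of_le_one_right (M.q_nonneg u v) (hc1 v hv))
    refine ⟨c', h0, h1, hmass.trans ?_, hvar.trans ?_⟩
    · simp_rw [mul_sum]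
      rw [sum_comm]
      refine sum_congr rfl fun v _ => ?_
      rw [← sum_pm_mul_q hl, sum_mul]
      exact sum_congr rfl fun u _ => by ring
    · rw [← energy_add hst t.le_succ, add_comm (energy M s₀ s t), ← add_assoc]
      gcongr
      have h2 : energy M s₀ t (t + 1) = stepEnergy M s₀ t := by simp [energy]
      simp_rw [h2, stepEnergy, mul_sum, sum_mul]
      rw [sum_comm, sum_comm (s := M.L t), ← sum_add_distrib]
      refine sum_le_sum fun v hv => ?_
      have h3 := sum_sq_sub hs hpos hl hv z
      have h4 : ∑ u ∈ M.L t, pm M t u * (M.q u v * c v) * (A M s₀ t u - z) ^ 2 =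
          c v * ∑ u ∈ M.L t, pm M t u * M.q u v * (A M s₀ t u - z) ^ 2 := by
        rw [mul_sum]
        exact sum_congr rfl fun u _ => by ring
      have h5 : 0 ≤ ∑ u ∈ M.L t, pm M t u * M.q u v * (A M s₀ t u - A M s₀ (t + 1) v) ^ 2 :=
        sum_nonneg fun u _ => mul_nonneg (flow_nonneg t u v) (sq_nonneg _)
      rw [h4, h3]
      nlinarith [hc1 v hv]

lemma exists_close_ancestor (hs : s₀ ∈ M.L 0)
    (hpos : ∀ l, l ≤ M.N → ∀ u ∈ M.L l, 0 < pm M l u) {s t : ℕ} (hst : s ≤ t)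
    (ht : t ≤ M.N) {v : V} (hv : v ∈ M.L t) :
    ∃ u ∈ M.L s, pm M t v * (A M s₀ s u - A M s₀ t v) ^ 2 ≤ energy M s₀ s t := by
  obtain ⟨c, h0, h1, hmass, hvar⟩ := exists_backward_weight hs hpos (A M s₀ t v) hst ht
    (fun w => if w = v then 1 else 0) (fun w => by split_ifs <;> norm_num)
    (fun w _ => by split_ifs <;> norm_num)
  simp only [mul_ite, mul_one, mul_zero, sum_ite_eq', hv, if_true, ite_mul, zero_mul, sub_self,
    ne_eq, OfNat.ofNat_ne_zero, not_false_eq_true, zero_pow, zero_add] at hmass hvar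
  by_contra! hcon
  have hp := hpos t ht v hv
  have hne : ∃ u ∈ M.L s, 0 < pm M s u * c u := by
    by_contra! hle
    exact absurd (sum_nonpos hle) (by rw [hmass]; exact hp.not_ge)
  have hlt : ∑ u ∈ M.L s, pm M s u * c u * energy M s₀ s t <
      ∑ u ∈ M.L s, pm M s u * c u * (pm M t v * (A M s₀ s u - A M s₀ t v) ^ 2) := by
    refine sum_lt_sum (fun u hu => ?_) ?_
    · exact mul_le_mul_of_nonneg_left (hcon u hu).le (mul_nonneg (pm_nonneg_s11 s u) (h0 u))
    · obtain ⟨u, hu, hpu⟩ := hne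
      exact ⟨u, hu, mul_lt_mul_of_pos_left (hcon u hu) hpu⟩
  have heq : ∑ u ∈ M.L s, pm M s u * c u * (pm M t v * (A M s₀ s u - A M s₀ t v) ^ 2) =
      pm M t v * ∑ u ∈ M.L s, pm M s u * c u * (A M s₀ s u - A M s₀ t v) ^ 2 := by
    rw [mul_sum]
    exact sum_congr rfl fun u _ => by ring
  rw [← sum_mul, hmass, heq] at hlt
  exact (lt_of_mul_lt_mul_left hlt hp.le).not_ge hvar

/-- The capacity crossing between level sets is bounded by the mass near the levels and the
energy of the long edges. -/
lemma crossCap_le_band_add {l : ℕ} (hl : l < M.N) {e lo hi lo' hi' : ℝ} (he : 0 < e)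
    {P Q : Finset V} (hP : IsLevelSet M s₀ lo hi l P) (hQ : IsLevelSet M s₀ lo' hi' (l + 1) Q) :
    crossCap M l P Q ≤ ∑ v ∈ band M s₀ (lo - e) hi' (l + 1), pm M (l + 1) v +
      stepEnergy M s₀ l / e ^ 2 := by
  have hband : ∑ v ∈ band M s₀ (lo - e) hi' (l + 1), pm M (l + 1) v =
      ∑ u ∈ M.L l, ∑ v ∈ M.L (l + 1),
        if lo - e < A M s₀ (l + 1) v ∧ A M s₀ (l + 1) v < hi' then pm M l u * M.q u v else 0 := by
    rw [band, sum_filter, sum_comm]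
    refine sum_congr rfl fun v _ => ?_
    split_ifs
    · exact (sum_pm_mul_q hl v).symm
    · simp
  have hnn : ∀ u v, 0 ≤ (if lo - e < A M s₀ (l + 1) v ∧ A M s₀ (l + 1) v < hi'
      then pm M l u * M.q u v else 0) +
        pm M l u * M.q u v * (A M s₀ l u - A M s₀ (l + 1) v) ^ 2 / e ^ 2 := fun u v =>
    add_nonneg (by split_ifs; exacts [flow_nonneg l u v, le_rfl])
      (div_nonneg (mul_nonneg (flow_nonneg l u v) (sq_nonneg _)) (sq_nonneg _))
  rw [hband, stepEnergy, sum_div, ← sum_add_distrib]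
  simp_rw [sum_div, ← sum_add_distrib]
  refine (sum_le_sum fun u hu => ?_).trans
    (sum_le_sum_of_subset_of_nonneg hP.1 fun u _ _ => sum_nonneg fun v _ => hnn u v)
  refine (sum_le_sum fun v hv => ?_).trans
    (sum_le_sum_of_subset_of_nonneg sdiff_subset fun v _ _ => hnn u v)
  obtain ⟨hv, hvQ⟩ := mem_sdiff.1 hv
  have hu' := (hP.2 u (hP.1 hu)).2 hu
  have hv' : A M s₀ (l + 1) v < hi' := by
    by_contra! h
    exact hvQ ((hQ.2 v hv).1 h)
  have hf := flow_nonneg (M := M) l u v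
  by_cases hlo : lo - e < A M s₀ (l + 1) v
  · rw [if_pos ⟨hlo, hv'⟩]
    exact le_add_of_nonneg_right
      (div_nonneg (mul_nonneg hf (sq_nonneg _)) (sq_nonneg _))
  · rw [if_neg fun h => hlo h.1, zero_add, le_div_iff₀ (by positivity)]
    exact mul_le_mul_of_nonneg_left (by nlinarith) hf

/-- A family of level cuts between the layers `a` and `b` whose capacity is at most `K`. -/
def HasLevelCut (M : MarkovFlow V) (s₀ : V) (lo hi : ℝ) (a b : ℕ) (K : ℝ) : Prop :=
  ∃ S : ℕ → Finset V, (∀ l, a ≤ l → l ≤ b → IsLevelSet M s₀ lo hi l (S l)) ∧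
    ∑ l ∈ Ico a b, crossCap M l (S l) (S (l + 1)) ≤ K

lemma HasLevelCut.mono {lo hi lo' hi' K K' : ℝ} {a b : ℕ} (h : HasLevelCut M s₀ lo hi a b K)
    (hlo : lo' ≤ lo) (hhi : hi ≤ hi') (hK : K ≤ K') : HasLevelCut M s₀ lo' hi' a b K' := by
  obtain ⟨S, hS, hcap⟩ := h
  exact ⟨S, fun l hal hlb => (hS l hal hlb).mono hlo hhi, hcap.trans hK⟩

/-- Concatenation of level cuts on `[a, t]` and `[t + 1, b]`. -/
lemma HasLevelCut.concat {lo hi e K₁ K₂ : ℝ} {a t b : ℕ} (he : 0 < e) (hat : a ≤ t)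
    (htb : t + 1 ≤ b) (hb : b ≤ M.N) (h₁ : HasLevelCut M s₀ lo hi a t K₁)
    (h₂ : HasLevelCut M s₀ lo hi (t + 1) b K₂) :
    HasLevelCut M s₀ lo hi a b (K₁ + (∑ v ∈ band M s₀ (lo - e) hi (t + 1), pm M (t + 1) v +
      stepEnergy M s₀ t / e ^ 2) + K₂) := by
  obtain ⟨S₁, hS₁, hcap₁⟩ := h₁
  obtain ⟨S₂, hS₂, hcap₂⟩ := h₂
  refine ⟨fun l => if l ≤ t then S₁ l else S₂ l, fun l hal hlb => ?_, ?_⟩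
  · dsimp only
    split_ifs with hlt
    exacts [hS₁ l hal hlt, hS₂ l (by omega) hlb]
  · dsimp only
    rw [← sum_Ico_consecutive _ (hat.trans t.le_succ) htb, sum_Ico_succ_top hat]
    refine add_le_add (add_le_add ?_ ?_) ?_
    · refine le_of_eq_of_le (sum_congr rfl fun l hl => ?_) hcap₁
      have := mem_Ico.1 hl
      rw [if_pos (by omega), if_pos (by omega)]
    · rw [if_pos le_rfl, if_neg (by omega)]
      exact crossCap_le_band_add (by omega) he (hS₁ t hat le_rfl) (hS₂ (t + 1) le_rfl htb)
    · refine le_of_eq_of_le (sum_congr rfl fun l hl => ?_) hcap₂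
      have : t + 1 ≤ l := (mem_Ico.1 hl).1
      rw [if_neg (by omega), if_neg (by omega)]

lemma hasLevelCut_self {lo hi : ℝ} (h : lo < hi) (a : ℕ) : HasLevelCut M s₀ lo hi a a 0 :=
  ⟨fun l => (M.L l).filter fun v => hi ≤ A M s₀ l v,
    fun l _ _ => isLevelSet_superlevel h le_rfl l, by simp⟩

/-- There is a cheap level cut when the band contains no nodes. -/
lemma hasLevelCut_of_band_eq_empty {lo hi : ℝ} (h : lo < hi) {a b : ℕ}
    (hband : ∀ l, a ≤ l → l ≤ b → band M s₀ lo hi l = ∅) :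
    HasLevelCut M s₀ lo hi a b (energy M s₀ a b / (hi - lo) ^ 2) := by
  refine ⟨fun l => (M.L l).filter fun v => hi ≤ A M s₀ l v,
    fun l _ _ => isLevelSet_superlevel h le_rfl l, ?_⟩
  rw [energy, sum_div]
  refine sum_le_sum fun l hl => ?_
  obtain ⟨hal, hlb⟩ := mem_Ico.1 hl
  rw [crossCap, stepEnergy, sum_div]
  simp_rw [sum_div]
  have hnn : ∀ u v, 0 ≤ pm M l u * M.q u v * (A M s₀ l u - A M s₀ (l + 1) v) ^ 2 /
      (hi - lo) ^ 2 := fun u v =>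
    div_nonneg (mul_nonneg (flow_nonneg l u v) (sq_nonneg _)) (sq_nonneg _)
  refine (sum_le_sum fun u hu => ?_).trans
    (sum_le_sum_of_subset_of_nonneg (filter_subset _ _) fun u _ _ => sum_nonneg fun v _ => hnn u v)
  refine (sum_le_sum fun v hv => ?_).trans
    (sum_le_sum_of_subset_of_nonneg sdiff_subset fun v _ _ => hnn u v)
  obtain ⟨hv, hvQ⟩ := mem_sdiff.1 hv
  have hu' := (mem_filter.1 hu).2
  have hv' : A M s₀ (l + 1) v < hi := by
    by_contra! hA
    exact hvQ (mem_filter.2 ⟨hv, hA⟩)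
  have hv'' : A M s₀ (l + 1) v ≤ lo := by
    by_contra! hA
    have hmem : v ∈ band M s₀ lo hi (l + 1) := mem_filter.2 ⟨hv, hA, hv'⟩
    simp [hband (l + 1) (by omega) (by omega)] at hmem
  have hpos : 0 < hi - lo := sub_pos.2 h
  rw [le_div_iff₀ (by positivity)]
  exact mul_le_mul_of_nonneg_left (by nlinarith) (flow_nonneg l u v)

/-- If the energy spent on `[a, t]` is small compared with the mass of a band at time `t`, then
some node of that band has close ancestors in all layers of `[a, t]`. -/
lemma exists_persistent_level (hs : s₀ ∈ M.L 0)
    (hpos : ∀ l, l ≤ M.N → ∀ u ∈ M.L l, 0 < pm M l u) {lo hi e : ℝ} (he : 0 < e) {a t j : ℕ}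
    (ht : t ≤ M.N) (hcard : (band M s₀ lo hi t).card ≤ j)
    (hE : j * energy M s₀ a t < e ^ 2 * ∑ v ∈ band M s₀ lo hi t, pm M t v) :
    ∃ z, lo < z ∧ z < hi ∧ ∀ s, a ≤ s → s ≤ t → ∃ u ∈ M.L s, |A M s₀ s u - z| < e := by
  obtain ⟨v, hv, hlt⟩ : ∃ v ∈ band M s₀ lo hi t, energy M s₀ a t < e ^ 2 * pm M t v := by
    by_contra! hcon
    refine hE.not_ge ?_
    rw [mul_sum]
    refine (sum_le_card_nsmul _ _ _ hcon).trans ?_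
    rw [nsmul_eq_mul]
    exact mul_le_mul_of_nonneg_right (by exact_mod_cast hcard) (energy_nonneg a t)
  obtain ⟨hvL, hlo, hhi⟩ := mem_filter.1 hv
  refine ⟨A M s₀ t v, hlo, hhi, fun s has hst => ?_⟩
  obtain ⟨u, hu, hle⟩ := exists_close_ancestor hs hpos hst ht hvL
  refine ⟨u, hu, abs_lt_of_sq_lt_sq ?_ he.le⟩
  have h1 : energy M s₀ s t ≤ energy M s₀ a t := by
    rw [← energy_add has hst]
    exact le_add_of_nonneg_left (energy_nonneg a s)
  have hp := hpos t ht v hvL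
  nlinarith

/-- A subband that misses some node of a band has fewer nodes than the band. -/
lemma card_band_lt {lo hi lo' hi' : ℝ} {l : ℕ} (hlo : lo ≤ lo') (hhi : hi' ≤ hi) {u : V}
    (hu : u ∈ band M s₀ lo hi l) (hu' : u ∉ band M s₀ lo' hi' l) :
    (band M s₀ lo' hi' l).card < (band M s₀ lo hi l).card := by
  refine card_lt_card ⟨fun v hv => ?_, fun h => hu' (h hu)⟩
  obtain ⟨hv, h1, h2⟩ := mem_filter.1 hv
  exact mem_filter.2 ⟨hv, hlo.trans_lt h1, h2.trans_le hhi⟩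

/-- The constant in the bound for level cuts through bands with at most `j` nodes per layer. -/
noncomputable def cutConst : ℕ → ℝ
  | 0 => 1
  | j + 1 => 576 * (cutConst j / 4 + j + 2)

lemma cutConst_pos (j : ℕ) : 0 < cutConst j := by
  induction j with
  | zero => exact one_pos
  | succ j ih => rw [cutConst]; positivity

/-- A time interval during which the energy stays small compared with the mass of the central band
admits a level cut through a subband with fewer nodes. -/
lemma hasLevelCut_of_energy_lt (hs : s₀ ∈ M.L 0)
    (hpos : ∀ l, l ≤ M.N → ∀ u ∈ M.L l, 0 < pm M l u) {j : ℕ} {lo e C : ℝ} (he : 0 < e)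
    {a b : ℕ} (hab : a ≤ b) (hb : b ≤ M.N)
    (ih : ∀ x, (∀ l, a ≤ l → l ≤ b → (band M s₀ x (x + 2 * e) l).card ≤ j) →
      HasLevelCut M s₀ x (x + 2 * e) a b (C * energy M s₀ a b / (2 * e) ^ 2))
    (hcard : ∀ l, a ≤ l → l ≤ b → (band M s₀ lo (lo + 24 * e) l).card ≤ j + 1)
    (hE : a < b → ((j + 1 : ℕ) : ℝ) * energy M s₀ a b <
      e ^ 2 * ∑ v ∈ band M s₀ (lo + 8 * e) (lo + 16 * e) b, pm M b v) :
    HasLevelCut M s₀ (lo + 9 * e) (lo + 15 * e) a b (C * energy M s₀ a b / (2 * e) ^ 2) := by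
  rcases hab.eq_or_lt with rfl | hlt
  · exact (hasLevelCut_self (by linarith) a).mono le_rfl le_rfl (by simp [energy])
  have hsub : (band M s₀ (lo + 8 * e) (lo + 16 * e) b).card ≤ j + 1 := by
    refine le_trans (card_le_card fun v hv => ?_) (hcard b hab le_rfl)
    obtain ⟨hv, h1, h2⟩ := mem_filter.1 hv
    exact mem_filter.2 ⟨hv, by linarith, by linarith⟩
  obtain ⟨z, hlo, hhi, hz⟩ := exists_persistent_level hs hpos he hb hsub (hE hlt)
  rcases le_total (lo + 12 * e) z with hmid | hmid
  · refine (ih (lo + 9 * e) fun l hal hlb => ?_).mono le_rfl (by linarith) le_rfl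
    obtain ⟨u, hu, hclose⟩ := hz l hal hlb
    obtain ⟨h1, h2⟩ := abs_lt.1 hclose
    refine Nat.lt_succ_iff.1 ((card_band_lt (u := u) (by linarith) (by linarith)
      (mem_filter.2 ⟨hu, by linarith, by linarith⟩) fun h => ?_).trans_le (hcard l hal hlb))
    linarith [(mem_filter.1 h).2.2]
  · refine (ih (lo + 13 * e) fun l hal hlb => ?_).mono (by linarith) (by linarith) le_rfl
    obtain ⟨u, hu, hclose⟩ := hz l hal hlb
    obtain ⟨h1, h2⟩ := abs_lt.1 hclose
    refine Nat.lt_succ_iff.1 ((card_band_lt (u := u) (by linarith) (by linarith)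
      (mem_filter.2 ⟨hu, by linarith, by linarith⟩) fun h => ?_).trans_le (hcard l hal hlb))
    linarith [(mem_filter.1 h).2.1]

lemma hasLevelCut_step (hs : s₀ ∈ M.L 0)
    (hpos : ∀ l, l ≤ M.N → ∀ u ∈ M.L l, 0 < pm M l u) {j : ℕ} {lo e C : ℝ} (he : 0 < e)
    (hC : 0 ≤ C)
    (ih : ∀ x a b, a ≤ b → b ≤ M.N →
      (∀ l, a ≤ l → l ≤ b → (band M s₀ x (x + 2 * e) l).card ≤ j) →
      HasLevelCut M s₀ x (x + 2 * e) a b (C * energy M s₀ a b / (2 * e) ^ 2))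
    {a b : ℕ} (hab : a ≤ b) (hb : b ≤ M.N)
    (hcard : ∀ l, a ≤ l → l ≤ b → (band M s₀ lo (lo + 24 * e) l).card ≤ j + 1) :
    HasLevelCut M s₀ (lo + 9 * e) (lo + 15 * e) a b
      ((C / 4 + j + 2) * energy M s₀ a b / e ^ 2) := by
  induction hn : b - a using Nat.strong_induction_on generalizing a with
  | _ n IH =>
  subst hn
  have hsq : (2 * e) ^ 2 = 4 * e ^ 2 := by ring
  have he2 : 0 < e ^ 2 := by positivity
  by_cases hex : ∃ t, a < t ∧ t ≤ b ∧
      e ^ 2 * ∑ v ∈ band M s₀ (lo + 8 * e) (lo + 16 * e) t, pm M t v ≤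
        ((j + 1 : ℕ) : ℝ) * energy M s₀ a t
  · classical
    obtain ⟨hat, htb, hmass⟩ := Nat.find_spec hex
    have hmin := fun m (hm : m < Nat.find hex) => Nat.find_min hex hm
    generalize Nat.find hex = t' at hat htb hmass hmin
    obtain ⟨t, rfl⟩ : ∃ t, t' = t + 1 := ⟨t' - 1, by omega⟩
    have hat' : a ≤ t := by omega
    have h₁ := hasLevelCut_of_energy_lt hs hpos he hat' (by omega)
      (fun x => ih x a t hat' (by omega)) (fun l hal hlt => hcard l hal (by omega))
      (fun hlt => by
        by_contra! hle
        exact hmin t t.lt_succ_self ⟨hlt, by omega, hle⟩)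
    have h₂ := IH (b - (t + 1)) (by omega) htb
      (fun l hal hlb => hcard l (by omega) hlb) rfl
    refine (h₁.concat he hat' htb hb h₂).mono le_rfl le_rfl ?_
    have hband : ∑ v ∈ band M s₀ (lo + 9 * e - e) (lo + 15 * e) (t + 1), pm M (t + 1) v ≤
        ∑ v ∈ band M s₀ (lo + 8 * e) (lo + 16 * e) (t + 1), pm M (t + 1) v := by
      refine sum_le_sum_of_subset_of_nonneg (fun v hv => ?_) fun v _ _ => pm_nonneg_s11 _ v
      obtain ⟨hv, h1, h2⟩ := mem_filter.1 hv
      exact mem_filter.2 ⟨hv, by linarith, by linarith⟩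
    have hmass' : ∑ v ∈ band M s₀ (lo + 8 * e) (lo + 16 * e) (t + 1), pm M (t + 1) v ≤
        (j + 1) * energy M s₀ a (t + 1) / e ^ 2 := by
      rw [le_div_iff₀ he2, mul_comm]
      exact_mod_cast hmass
    have hadd₁ := energy_add (M := M) (s₀ := s₀) hat' t.le_succ
    have hadd₂ := energy_add (M := M) (s₀ := s₀) hat.le htb
    have hstep : energy M s₀ t (t + 1) = stepEnergy M s₀ t := by simp [energy]
    rw [Nat.succ_eq_add_one, hstep] at hadd₁
    have hEat := energy_nonneg (M := M) (s₀ := s₀) a t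
    have hst := stepEnergy_nonneg (M := M) (s₀ := s₀) t
    have hfin : C * energy M s₀ a t / (2 * e) ^ 2 + ((j + 1) * energy M s₀ a (t + 1) / e ^ 2 +
        stepEnergy M s₀ t / e ^ 2) ≤ (C / 4 + j + 2) * energy M s₀ a (t + 1) / e ^ 2 := by
      rw [hsq, ← div_div, ← add_div, ← add_div, ← hadd₁]
      gcongr
      nlinarith [mul_nonneg hC hst]
    have hsplit : (C / 4 + j + 2) * energy M s₀ a b / e ^ 2 =
        (C / 4 + j + 2) * energy M s₀ a (t + 1) / e ^ 2 +
          (C / 4 + j + 2) * energy M s₀ (t + 1) b / e ^ 2 := by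
      rw [← hadd₂]
      ring
    linarith
  · push Not at hex
    refine (hasLevelCut_of_energy_lt hs hpos he hab hb (fun x => ih x a b hab hb) hcard
      fun hlt => hex b hlt le_rfl).mono le_rfl le_rfl ?_
    rw [hsq, ← div_div]
    gcongr
    nlinarith [energy_nonneg (M := M) (s₀ := s₀) a b,
      mul_nonneg (Nat.cast_nonneg (α := ℝ) j) (energy_nonneg (M := M) (s₀ := s₀) a b)]

/-- A band with at most `j` nodes per layer admits a level cut whose capacity is at most a constant
times the energy. -/
theorem hasLevelCut_of_card_band_le (hs : s₀ ∈ M.L 0)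
    (hpos : ∀ l, l ≤ M.N → ∀ u ∈ M.L l, 0 < pm M l u) (j : ℕ) {lo hi : ℝ} (h : lo < hi)
    {a b : ℕ} (hab : a ≤ b) (hb : b ≤ M.N)
    (hcard : ∀ l, a ≤ l → l ≤ b → (band M s₀ lo hi l).card ≤ j) :
    HasLevelCut M s₀ lo hi a b (cutConst j * energy M s₀ a b / (hi - lo) ^ 2) := by
  induction j generalizing lo hi a b with
  | zero =>
    rw [cutConst, one_mul]
    exact hasLevelCut_of_band_eq_empty h fun l hal hlb =>
      card_eq_zero.1 (Nat.le_zero.1 (hcard l hal hlb))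
  | succ j ih =>
    obtain ⟨e, rfl⟩ : ∃ e, hi = lo + 24 * e := ⟨(hi - lo) / 24, by ring⟩
    have he : 0 < e := by linarith
    refine (hasLevelCut_step hs hpos he (cutConst_pos j).le (fun x a b hab hb hc => ?_) hab hb
      hcard).mono (by linarith) (by linarith) (le_of_eq ?_)
    · simpa using ih (lo := x) (hi := x + 2 * e) (by linarith) hab hb hc
    · rw [cutConst]
      field_simp
      ring

lemma ecap_eq {l : ℕ} (hl : l < M.N) {u : V} (hu : u ∈ M.L l) (v : V) :
    ecap M u v = pm M l u * M.q u v := by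
  rw [ecap, sum_eq_single_of_mem l (mem_range.2 hl), if_pos hu]
  intro m hm hml
  exact if_neg fun hum => hml (layer_eq (mem_range.1 hm).le hl.le hum hu)

/-- A level cut separates a source above the band from a sink below it. -/
lemma HasLevelCut.exists_separates {lo hi K : ℝ} {t₁ : V} (h : HasLevelCut M s₀ lo hi 0 M.N K)
    (hs : s₀ ∈ M.L 0) (ht : t₁ ∈ M.L M.N) (hs' : hi ≤ A M s₀ 0 s₀) (ht' : A M s₀ M.N t₁ ≤ lo) :
    ∃ T : Finset (V × V), M.Separates s₀ t₁ T ∧ ∑ e ∈ T, ecap M e.1 e.2 ≤ K := by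
  obtain ⟨S, hS, hcap⟩ := h
  refine ⟨(range M.N).biUnion fun l => S l ×ˢ (M.L (l + 1) \ S (l + 1)),
    fun u hu0 huN huL _ => ?_, le_trans ?_ hcap⟩
  · by_contra! hcon
    have hmem : ∀ l, l ≤ M.N → u l ∈ S l := by
      intro l
      induction l with
      | zero => exact fun _ => hu0 ▸ ((hS 0 le_rfl (Nat.zero_le _)).2 s₀ hs).1 hs'
      | succ l ih =>
        intro hl
        by_contra hnot
        exact hcon l hl (mem_biUnion.2 ⟨l, mem_range.2 hl,
          mem_product.2 ⟨ih (by omega), mem_sdiff.2 ⟨huL _ hl, hnot⟩⟩⟩)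
    have htS : t₁ ∈ S M.N := huN ▸ hmem M.N le_rfl
    exact ht'.not_gt (((hS M.N (Nat.zero_le _) le_rfl).2 t₁ ht).2 htS)
  · rw [sum_biUnion]
    · rw [← Finset.range_eq_Ico]
      refine sum_le_sum fun l hl => le_of_eq ?_
      have hl := mem_range.1 hl
      rw [sum_product, crossCap]
      exact sum_congr rfl fun u hu => sum_congr rfl fun v _ =>
        ecap_eq hl ((hS l (Nat.zero_le _) hl.le).1 hu) v
    · intro l hl m hm hlm
      have hl := (mem_range.1 hl).le
      have hm := (mem_range.1 hm).le
      exact disjoint_product.2 (Or.inl ((M.layer_disjoint l m hl hm hlm).mono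
        (hS l (Nat.zero_le _) hl).1 (hS m (Nat.zero_le _) hm).1))

lemma A_zero_self (h : M.p0 s₀ ≠ 0) : A M s₀ 0 s₀ = 1 / 2 := by
  simp only [A, pj, cond, pm, Nat.sub_self, if_true, mul_one]
  rw [div_self h]
  norm_num

end MarkovFlow

/-- Lemma 7 of the paper: for every `k > 0` there is a constant `C(k) > 0`
such that every symmetric Markov flow graph with at most `k` nodes per layer, all node
probabilities positive and `A(t₁) < 0` admits a set `T` of edges separating `s₀` from `t₁` of
capacity at most `C·(φ(0) − φ(N))`. -/
theorem stmt11 (k : ℕ) (hk : 0 < k) :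
    ∃ C : ℝ, 0 < C ∧
      ∀ (V : Type) [Fintype V] [DecidableEq V],
      ∀ (M : MarkovFlow V) (s₀ s₁ t₀ t₁ : V),
        M.L 0 = {s₀, s₁} → s₀ ≠ s₁ → M.p0 s₀ = 1 / 2 → M.p0 s₁ = 1 / 2 →
        M.L M.N = {t₀, t₁} → t₀ ≠ t₁ →
        (∀ l, l ≤ M.N → ∀ u ∈ M.L l, 0 < MarkovFlow.pm M l u) →
        (∀ l, l ≤ M.N → (M.L l).card ≤ k) →
        M.Symm s₀ s₁ t₀ t₁ →
        MarkovFlow.A M s₀ M.N t₁ < 0 →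
        ∃ T : Finset (V × V), M.Separates s₀ t₁ T ∧
          (∑ e ∈ T, MarkovFlow.ecap M e.1 e.2) ≤
            C * (MarkovFlow.phi M s₀ 0 - MarkovFlow.phi M s₀ M.N) := by
  refine ⟨4 * MarkovFlow.cutConst k, by linarith [MarkovFlow.cutConst_pos k], ?_⟩
  intro V _ _ M s₀ s₁ t₀ t₁ hL0 _ hp0 _ hLN _ hpos hcard _ hA
  have hs : s₀ ∈ M.L 0 := by simp [hL0]
  have ht : t₁ ∈ M.L M.N := by simp [hLN]
  have hcut := MarkovFlow.hasLevelCut_of_card_band_le hs hpos k (lo := 0) (hi := 1 / 2)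
    (by norm_num) (Nat.zero_le M.N) le_rfl
    fun l _ hl => (card_le_card (filter_subset _ _)).trans (hcard l hl)
  obtain ⟨T, hT, hcap⟩ := hcut.exists_separates hs ht
    (MarkovFlow.A_zero_self (by rw [hp0]; norm_num)).ge hA.le
  refine ⟨T, hT, hcap.trans (le_of_eq ?_)⟩
  rw [MarkovFlow.phi_sub_phi hs hpos]
  ring
end
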